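/- arXiv:1711.08539 — 6 statements merged into one kernel-verified Lean document; each statement's English description precedes it below -/
import Mathlib

section
/- For every sufficiently large integer q and every integer n with 1 ≤ n < q/(20 log² q), there exist n distinct primes b₁, …, bₙ, all lying in the interval (5n log² q, 10n log² q], none of which divides q. -/
theorem centralBinom_le_aux (n : ℕ) (n_large : 2 < n) :
    Nat.centralBinom n ≤ (2 * n) ^ Nat.sqrt (2 * n) * 4 ^ (2 * n / 3) *
      ∏ p ∈ (Finset.Ioc n (2 * n)).filter Nat.Prime, p := by
  have n_pos : 0 < n := by omega
  have n2_pos : 1 ≤ 2 * n := by omega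
  let S := {p ∈ Finset.range (2 * n / 3 + 1) | Nat.Prime p}
  let f : ℕ → ℕ := fun x => x ^ n.centralBinom.factorization x
  have h0 : ∏ x ∈ S, f x = ∏ x ∈ Finset.range (2 * n / 3 + 1), f x := by
    refine Finset.prod_filter_of_ne fun p _ h => ?_
    contrapose h; dsimp only [f]
    rw [Nat.factorization_eq_zero_of_not_prime n.centralBinom h, _root_.pow_zero]
  have hsplit : n.centralBinom = (∏ x ∈ Finset.range (2 * n / 3 + 1), f x) *
      ∏ x ∈ Finset.Ico (2 * n / 3 + 1) (2 * n + 1), f x := by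
    rw [Finset.prod_range_mul_prod_Ico _ (by omega)]
    exact n.prod_pow_factorization_centralBinom.symm
  have htail : ∏ x ∈ Finset.Ico (2 * n / 3 + 1) (2 * n + 1), f x ≤
      ∏ p ∈ (Finset.Ioc n (2 * n)).filter Nat.Prime, p := by
    have hsub : (Finset.Ioc n (2 * n)).filter Nat.Prime ⊆
        Finset.Ico (2 * n / 3 + 1) (2 * n + 1) := by
      intro p hp
      simp only [Finset.mem_filter, Finset.mem_Ioc, Finset.mem_Ico] at hp ⊢
      omega
    rw [← Finset.prod_subset hsub (f := f)]
    · refine Finset.prod_le_prod' fun p hp => ?_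
      simp only [Finset.mem_filter, Finset.mem_Ioc] at hp
      refine (pow_right_mono₀ hp.2.one_lt.le ?_).trans (pow_one p).le
      exact Nat.factorization_choose_le_one (by nlinarith)
    · intro x hx hx2
      simp only [Finset.mem_filter, Finset.mem_Ioc, Finset.mem_Ico] at hx hx2
      dsimp only [f]
      by_cases hp : x.Prime
      · have : x ≤ n := by
          by_contra h
          exact hx2 ⟨⟨by omega, by omega⟩, hp⟩
        rw [Nat.factorization_centralBinom_of_two_mul_self_lt_three_mul n_large this (by omega),
          pow_zero]
      · rw [Nat.factorization_eq_zero_of_not_prime n.centralBinom hp, pow_zero]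
  rw [hsplit]
  refine mul_le_mul' ?_ htail
  rw [← h0, ← Finset.prod_filter_mul_prod_filter_not S (· ≤ Nat.sqrt (2 * n))]
  apply mul_le_mul'
  · refine (Finset.prod_le_prod' fun p _ => (?_ : f p ≤ 2 * n)).trans ?_
    · exact Nat.pow_factorization_choose_le (mul_pos two_pos n_pos)
    have : (Finset.Icc 1 (Nat.sqrt (2 * n))).card = Nat.sqrt (2 * n) := by
      rw [Nat.card_Icc, Nat.add_sub_cancel]
    rw [Finset.prod_const]
    refine pow_right_mono₀ n2_pos ((Finset.card_le_card fun x hx => ?_).trans this.le)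
    obtain ⟨h1, h2⟩ := Finset.mem_filter.1 hx
    exact Finset.mem_Icc.mpr ⟨(Finset.mem_filter.1 h1).2.one_lt.le, h2⟩
  · refine le_trans ?_ (primorial_le_four_pow (2 * n / 3))
    refine (Finset.prod_le_prod' fun p hp => (?_ : f p ≤ p)).trans ?_
    · obtain ⟨h1, h2⟩ := Finset.mem_filter.1 hp
      refine (pow_right_mono₀ (Finset.mem_filter.1 h1).2.one_lt.le ?_).trans (pow_one p).le
      exact Nat.factorization_choose_le_one (Nat.sqrt_lt'.mp <| not_le.1 h2)
    refine Finset.prod_le_prod_of_subset_of_one_le' (Finset.filter_subset _ _) ?_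
    exact fun p hp _ => (Finset.mem_filter.1 hp).2.one_lt.le

theorem log_prod_aux (m : ℕ) (hm : 10000000 ≤ m) :
    (m : ℝ) / 4 ≤ Real.log ((∏ p ∈ (Finset.Ioc m (2 * m)).filter Nat.Prime, p : ℕ) : ℝ) := by
  set P : ℕ := ∏ p ∈ (Finset.Ioc m (2 * m)).filter Nat.Prime, p with hP
  have hPpos : 0 < P := Finset.prod_pos fun p hp => (Finset.mem_filter.1 hp).2.pos
  have hPr : (0 : ℝ) < P := by exact_mod_cast hPpos
  have hmr : (10000000 : ℝ) ≤ m := by exact_mod_cast hm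
  have hm0 : (0 : ℝ) < m := by linarith
  have h1 : 4 ^ m ≤ m * ((2 * m) ^ Nat.sqrt (2 * m) * 4 ^ (2 * m / 3) * P) :=
    (Nat.four_pow_lt_mul_centralBinom m (by omega)).le.trans
      (Nat.mul_le_mul_left _ (centralBinom_le_aux m (by omega)))
  have h2 : ((4 : ℝ) ^ m) ≤
      m * ((2 * m) ^ Nat.sqrt (2 * m) * 4 ^ (2 * m / 3) * P) := by exact_mod_cast h1
  have h3 := Real.log_le_log (by positivity) h2
  rw [Real.log_mul (by positivity) (by positivity), Real.log_mul (by positivity) (by positivity),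
    Real.log_mul (by positivity) (by positivity), Real.log_pow, Real.log_pow, Real.log_pow] at h3
  have hy : (0 : ℝ) < 2 * m := by positivity
  set y : ℝ := 2 * m with hydef
  set s : ℝ := √(√y) with hs
  have hs2 : s ^ 2 = √y := Real.sq_sqrt (Real.sqrt_nonneg _)
  have hs4 : s ^ 4 = y := by
    rw [show s ^ 4 = (s ^ 2) ^ 2 by ring, hs2, Real.sq_sqrt hy.le]
  have hs50 : 50 ≤ s := by
    apply Real.le_sqrt_of_sq_le
    apply Real.le_sqrt_of_sq_le
    norm_num; linarith
  have hlogy : Real.log y ≤ 4 * s := by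
    rw [← hs4, Real.log_pow]
    have := Real.log_le_self (show 0 ≤ s by linarith)
    push_cast; linarith
  have hlogy0 : 0 ≤ Real.log y := Real.log_nonneg (by linarith)
  have hlogm : Real.log m ≤ Real.log y := Real.log_le_log hm0 (by linarith)
  have hsq : (Nat.sqrt (2 * m) : ℝ) ≤ s ^ 2 := by
    rw [hs2, hydef]
    have := @Real.nat_sqrt_le_real_sqrt (2 * m)
    push_cast at this
    exact this
  have hdiv : ((2 * m / 3 : ℕ) : ℝ) ≤ 2 * m / 3 := by
    have := @Nat.cast_div_le ℝ _ _ _ (2 * m) 3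
    push_cast at this
    exact this
  have hl4 : Real.log 4 = 2 * Real.log 2 := by
    rw [show (4 : ℝ) = 2 ^ 2 by norm_num, Real.log_pow]; norm_num
  have hl2 := Real.log_two_gt_d9
  have e1 : (Nat.sqrt (2 * m) : ℝ) * Real.log y ≤ s ^ 2 * (4 * s) :=
    mul_le_mul hsq hlogy hlogy0 (by positivity)
  have e2 : ((2 * m / 3 : ℕ) : ℝ) * Real.log 4 ≤ 2 * m / 3 * Real.log 4 :=
    mul_le_mul_of_nonneg_right hdiv (by linarith)
  have e3 : (m : ℝ) * 1.38 ≤ m * Real.log 4 :=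
    mul_le_mul_of_nonneg_left (by linarith) hm0.le
  have e4 : s ^ 2 * (4 * s) + 4 * s ≤ s ^ 4 / 10 := by
    have a : s ^ 2 * (4 * s) + 4 * s ≤ 5 * s ^ 3 := by nlinarith [sq_nonneg s]
    have b : 50 * s ^ 3 ≤ s ^ 4 := by
      rw [show s ^ 4 = s * s ^ 3 by ring]
      exact mul_le_mul_of_nonneg_right hs50 (by positivity)
    linarith
  linarith

theorem primes_in_interval :
    ∃ Q₀ : ℕ, ∀ q : ℕ, Q₀ ≤ q → ∀ n : ℕ, 1 ≤ n →
      (n : ℝ) < (q : ℝ) / (20 * Real.log q ^ 2) →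
      ∃ b : Fin n → ℕ, Function.Injective b ∧
        ∀ i, (b i).Prime ∧ ¬ (b i ∣ q) ∧
          5 * (n : ℝ) * Real.log q ^ 2 < (b i : ℝ) ∧
          (b i : ℝ) ≤ 10 * (n : ℝ) * Real.log q ^ 2 := by
  have hev : ∀ᶠ q : ℕ in Filter.atTop, (10000000 : ℝ) ≤ Real.log q :=
    (Real.tendsto_log_atTop.comp tendsto_natCast_atTop_atTop).eventually_ge_atTop _
  obtain ⟨Q, hQ⟩ := Filter.eventually_atTop.1 hev
  refine ⟨max Q 1, fun q hq n hn hnq => ?_⟩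
  have hL := hQ q (le_trans (le_max_left _ _) hq)
  have hq1 : 1 ≤ q := le_trans (le_max_right _ _) hq
  have hn1 : (1 : ℝ) ≤ n := by exact_mod_cast hn
  set L := Real.log q with hLdef
  have hL0 : 0 < L := by linarith
  rw [lt_div_iff₀ (by positivity)] at hnq
  set N : ℝ := 5 * n * L ^ 2 with hN
  have hN0 : 0 ≤ N := by positivity
  have hNL : 10000000 * (5 * (n * L)) ≤ N := by
    have : 0 ≤ 5 * (n * L) := by positivity
    nlinarith [mul_le_mul_of_nonneg_right hL this]
  have hnL : L ≤ n * L := by nlinarith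
  set m : ℕ := ⌊N⌋₊ with hm
  have hmN : (m : ℝ) ≤ N := Nat.floor_le hN0
  have hNm : N < m + 1 := Nat.lt_floor_add_one N
  have hmbig : 10000000 ≤ m := by
    apply Nat.le_floor; push_cast; linarith
  have hmq : 2 * m ≤ q := by
    have : (2 * m : ℝ) ≤ q := by nlinarith
    exact_mod_cast this
  set S := (Finset.Ioc m (2 * m)).filter Nat.Prime with hS
  set A := S.filter (fun p => ¬ p ∣ q) with hA
  have hcard : n ≤ A.card := by
    by_contra hlt
    have hlog := log_prod_aux m hmbig
    rw [← hS, ← Finset.prod_filter_mul_prod_filter_not S (fun p => p ∣ q), ← hA] at hlog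
    have hD : ∏ p ∈ S.filter (fun p => p ∣ q), p ≤ q := by
      apply Nat.le_of_dvd hq1
      apply Finset.prod_primes_dvd
      · intro p hp
        exact (Finset.mem_filter.1 (Finset.mem_filter.1 hp).1).2.prime
      · intro p hp
        exact (Finset.mem_filter.1 hp).2
    have hAp : ∏ p ∈ A, p ≤ q ^ n := by
      calc ∏ p ∈ A, p ≤ q ^ A.card := by
            apply Finset.prod_le_pow_card
            intro p hp
            have := (Finset.mem_Ioc.1 (Finset.mem_filter.1 (Finset.mem_filter.1 hp).1).1).2
            omega
        _ ≤ q ^ n := Nat.pow_le_pow_right hq1 (by omega)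
    have hpos : 0 < (∏ p ∈ S.filter (fun p => p ∣ q), p) * ∏ p ∈ A, p := by
      apply Nat.mul_pos <;> apply Finset.prod_pos <;> intro p hp <;>
        exact (Finset.mem_filter.1 (Finset.mem_filter.1 hp).1).2.pos
    have hle : (((∏ p ∈ S.filter (fun p => p ∣ q), p) * ∏ p ∈ A, p : ℕ) : ℝ) ≤ (q : ℝ) ^ (n + 1) := by
      have := Nat.mul_le_mul hD hAp
      rw [← pow_succ'] at this
      exact_mod_cast this
    have h5 := Real.log_le_log (by exact_mod_cast hpos) hle
    rw [Real.log_pow, ← hLdef] at h5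
    have h6 := hlog.trans h5
    push_cast at h6
    nlinarith
  obtain ⟨T, hT, hTc⟩ := Finset.exists_subset_card_eq hcard
  refine ⟨T.orderEmbOfFin hTc, (T.orderEmbOfFin hTc).injective, fun i => ?_⟩
  have hi := hT (T.orderEmbOfFin_mem hTc i)
  generalize T.orderEmbOfFin hTc i = p at hi
  simp only [hA, hS, Finset.mem_filter, Finset.mem_Ioc] at hi
  obtain ⟨⟨⟨h1, h2⟩, h3⟩, h4⟩ := hi
  refine ⟨h3, h4, ?_, ?_⟩
  · have : ((m + 1 : ℕ) : ℝ) ≤ p := by exact_mod_cast h1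
    push_cast at this
    linarith
  · have : (p : ℝ) ≤ 2 * m := by exact_mod_cast h2
    linarith
end

section
/- Let θ : ℝ → (0,1) be an increasing, three times continuously differentiable function for which there is a constant K ≥ 1 with θ(−x) ≤ K e^{−x} and 1 − θ(x) ≤ K e^{−x} for all x ≥ 0, and |θ^{(m)}(x)| ≤ K θ(x) for all x ∈ ℝ and m = 1,2,3. Let n ≥ 1, δ > 0, and let Sate ⊆ {1,…,n}×{1,…,n} be admissible. Then h_{S,δ}^{−} and h_{S,δ}^{+} are three times continuously differentiable functions from ℝⁿ to [0, ∞) satisfying h_{S,δ}^{±}(x) ≤ 1 for all x, and there is a constant C depending only on K such that for all x ∈ ℝⁿ: sup_{1 ≤ i ≤ n} |∂h_{S,δ}^{±}(x)/∂x_i| ≤ C (n/δ) h_{S,δ}^{±}(x) and sup_{1 ≤ i,j,k ≤ n} |∂³h_{S,δ}^{±}(x)/(∂x_i ∂x_j ∂x_k)| ≤ C (n/δ)³ h_{S,δ}^{±}(x). -/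
/-- A set `S` of pairs of indices is admissible if
`R(S) = {x : x i > x j for all (i,j) ∈ S}` is nonempty. -/
def Admissible {n : ℕ} (S : Finset (Fin n × Fin n)) : Prop :=
  ∃ x : Fin n → ℝ, ∀ p ∈ S, x p.2 < x p.1

/-- The smooth test function `h_{S,δ}^{±}(x) = ∏_{(i,j) ∈ S} θ((x i - x j ± √δ)/δ)`,
where the sign is `e = 1` for `h⁺` and `e = -1` for `h⁻`. -/
noncomputable def hSD (θ : ℝ → ℝ) {n : ℕ} (S : Finset (Fin n × Fin n)) (δ e : ℝ)
    (x : Fin n → ℝ) : ℝ :=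
  ∏ p ∈ S, θ ((x p.1 - x p.2 + e * Real.sqrt δ) / δ)


namespace SmoothTest

theorem iter_step {E : Type*} [NormedAddCommGroup E] [NormedSpace ℝ E] {f : E → ℝ}
    (hf : ContDiff ℝ 3 f) {m : ℕ} (hm : m < 3) (w : Fin (m + 1) → E) (g : E → ℝ) (g' : ℝ) (x : E)
    (hg : ∀ y, iteratedFDeriv ℝ m f y (Fin.tail w) = g y)
    (hl : HasLineDerivAt ℝ g g' x (w 0)) :
    iteratedFDeriv ℝ (m + 1) f x w = g' := by
  have hd : Differentiable ℝ (fun y => iteratedFDeriv ℝ m f y) :=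
    ContDiff.differentiable_iteratedFDeriv (by exact_mod_cast hm) hf
  rw [iteratedFDeriv_succ_apply_left]
  have h1 := fderiv_continuousMultilinear_apply_const_apply (hd x) (Fin.tail w) (w 0)
  have h2 : (fun y => iteratedFDeriv ℝ m f y (Fin.tail w)) = g := funext hg
  have h3 : DifferentiableAt ℝ g x := by
    rw [← h2]
    exact (hd x).continuousMultilinear_apply_const _
  rw [h2, ← h3.lineDeriv_eq_fderiv, hl.lineDeriv] at h1
  exact h1.symm

/-- The argument of `θ` in the factor `p`. -/
noncomputable def arg {n : ℕ} (δ e : ℝ) (p : Fin n × Fin n) (x : Fin n → ℝ) : ℝ :=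
  (x p.1 - x p.2 + e * Real.sqrt δ) / δ

/-- The derivative of `arg` in the direction `v`. -/
noncomputable def coef {n : ℕ} (δ : ℝ) (p : Fin n × Fin n) (v : Fin n → ℝ) : ℝ :=
  (v p.1 - v p.2) / δ

theorem comp_line {n : ℕ} (δ e : ℝ) (p : Fin n × Fin n) (φ φ' : ℝ → ℝ)
    (h : ∀ y, HasDerivAt φ (φ' y) y) (x v : Fin n → ℝ) :
    HasDerivAt (fun t : ℝ => φ (arg δ e p (x + t • v)))
      (coef δ p v * φ' (arg δ e p x)) 0 := by
  have h1 : HasDerivAt (fun t : ℝ => arg δ e p (x + t • v)) (coef δ p v) 0 := by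
    have : (fun t : ℝ => arg δ e p (x + t • v)) = fun t => t * coef δ p v + arg δ e p x := by
      funext t
      simp only [arg, coef, Pi.add_apply, Pi.smul_apply, smul_eq_mul]
      ring
    rw [this]
    simpa using ((hasDerivAt_id (0 : ℝ)).mul_const (coef δ p v)).add_const (arg δ e p x)
  have h2 := HasDerivAt.comp (0 : ℝ) (h (arg δ e p (x + (0 : ℝ) • v))) h1
  simp only [zero_smul, add_zero] at h2
  rw [mul_comm]
  exact h2

theorem sum_line {n : ℕ} (S : Finset (Fin n × Fin n)) (δ e : ℝ) (φ φ' : ℝ → ℝ)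
    (h : ∀ y, HasDerivAt φ (φ' y) y) (w : Fin n × Fin n → ℝ) (x v : Fin n → ℝ) :
    HasLineDerivAt ℝ (fun y => ∑ p ∈ S, w p * φ (arg δ e p y))
      (∑ p ∈ S, w p * coef δ p v * φ' (arg δ e p x)) x v := by
  unfold HasLineDerivAt
  apply HasDerivAt.fun_sum
  intro p _
  have := (comp_line δ e p φ φ' h x v).const_mul (w p)
  rwa [← mul_assoc] at this

theorem h_line {n : ℕ} (S : Finset (Fin n × Fin n)) (δ e : ℝ) (θ θ' : ℝ → ℝ)
    (h0 : ∀ y, 0 < θ y)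
    (h : ∀ y, HasDerivAt θ (θ' y) y) (x v : Fin n → ℝ) :
    HasLineDerivAt ℝ (hSD θ S δ e)
      (hSD θ S δ e x * ∑ p ∈ S, coef δ p v * (θ' (arg δ e p x) / θ (arg δ e p x))) x v := by
  unfold HasLineDerivAt
  have := HasDerivAt.fun_finsetProd (u := S)
    (f := fun p (t : ℝ) => θ (arg δ e p (x + t • v))) (fun p _ => comp_line δ e p θ θ' h x v)
  refine HasDerivAt.congr_deriv this ?_
  simp only [zero_smul, add_zero, smul_eq_mul]
  rw [Finset.mul_sum]
  refine Finset.sum_congr rfl fun p hp => ?_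
  have h2 : hSD θ S δ e x = θ (arg δ e p x) * ∏ q ∈ S.erase p, θ (arg δ e q x) :=
    (Finset.mul_prod_erase S (fun q => θ (arg δ e q x)) hp).symm
  rw [h2]
  have := (h0 (arg δ e p x)).ne'
  field_simp

theorem mul_line {n : ℕ} {f g : (Fin n → ℝ) → ℝ} {f' g' : ℝ} {x v : Fin n → ℝ}
    (hf : HasLineDerivAt ℝ f f' x v) (hg : HasLineDerivAt ℝ g g' x v) :
    HasLineDerivAt ℝ (fun y => f y * g y) (f' * g x + f x * g') x v := by
  have := HasDerivAt.mul hf hg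
  simp only [zero_smul, add_zero] at this
  exact this

theorem add_line {n : ℕ} {f g : (Fin n → ℝ) → ℝ} {f' g' : ℝ} {x v : Fin n → ℝ}
    (hf : HasLineDerivAt ℝ f f' x v) (hg : HasLineDerivAt ℝ g g' x v) :
    HasLineDerivAt ℝ (fun y => f y + g y) (f' + g') x v :=
  HasDerivAt.add hf hg

theorem coef_le {n : ℕ} (δ : ℝ) (hδ : 0 < δ) (p : Fin n × Fin n) (i : Fin n) :
    |coef δ p (Pi.single i 1)| ≤ 1 / δ := by
  unfold coef
  rw [abs_div, abs_of_pos hδ]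
  gcongr
  simp only [Pi.single_apply]
  split_ifs <;> norm_num

theorem sum_coef_le {n : ℕ} (S : Finset (Fin n × Fin n)) (δ : ℝ) (hδ : 0 < δ) (i : Fin n) :
    ∑ p ∈ S, |coef δ p (Pi.single i 1)| ≤ 2 * (n / δ) := by
  calc ∑ p ∈ S, |coef δ p (Pi.single i 1)|
      ≤ ∑ p : Fin n × Fin n, |coef δ p (Pi.single i 1)| :=
        Finset.sum_le_sum_of_subset_of_nonneg (Finset.subset_univ _) fun _ _ _ => abs_nonneg _
    _ ≤ ∑ p : Fin n × Fin n, ((if p.1 = i then 1 else 0) + (if p.2 = i then 1 else 0)) / δ := by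
        refine Finset.sum_le_sum fun p _ => ?_
        unfold coef
        rw [abs_div, abs_of_pos hδ]
        gcongr
        simp only [Pi.single_apply]
        split_ifs <;> norm_num
    _ = 2 * (n / δ) := by
        rw [← Finset.sum_div, Fintype.sum_prod_type]
        have h1 : ∑ x : Fin n, ∑ _y : Fin n, (if x = i then (1 : ℝ) else 0) = n := by
          rw [Finset.sum_comm]
          simp
        have h2 : ∑ _x : Fin n, ∑ y : Fin n, (if y = i then (1 : ℝ) else 0) = n := by
          simp
        simp only [Finset.sum_add_distrib]
        rw [h1, h2]
        ring

theorem sum_bound {n : ℕ} (S : Finset (Fin n × Fin n)) (δ : ℝ) (hδ : 0 < δ) (i : Fin n)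
    (r : Fin n × Fin n → ℝ) (B : ℝ) (hB : ∀ p, |r p| ≤ B) :
    |∑ p ∈ S, coef δ p (Pi.single i 1) * r p| ≤ 2 * (n / δ) * B := by
  have hB0 : ∀ p : Fin n × Fin n, 0 ≤ B := fun p => (abs_nonneg _).trans (hB p)
  calc _ ≤ ∑ p ∈ S, |coef δ p (Pi.single i 1) * r p| := Finset.abs_sum_le_sum_abs _ _
    _ ≤ ∑ p ∈ S, |coef δ p (Pi.single i 1)| * B := by
        refine Finset.sum_le_sum fun p _ => ?_
        rw [abs_mul]
        exact mul_le_mul_of_nonneg_left (hB p) (abs_nonneg _)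
    _ = (∑ p ∈ S, |coef δ p (Pi.single i 1)|) * B := by rw [Finset.sum_mul]
    _ ≤ _ := mul_le_mul_of_nonneg_right (sum_coef_le S δ hδ i) (hB0 (i, i))

end SmoothTest

open SmoothTest in
theorem smooth_test_function_properties (K : ℝ) (hK : 1 ≤ K) :
    ∃ C : ℝ, ∀ θ : ℝ → ℝ,
      (∀ x : ℝ, 0 < θ x ∧ θ x < 1) →
      Monotone θ →
      ContDiff ℝ 3 θ →
      (∀ x : ℝ, 0 ≤ x → θ (-x) ≤ K * Real.exp (-x) ∧ 1 - θ x ≤ K * Real.exp (-x)) →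
      (∀ m : ℕ, m ∈ ({1, 2, 3} : Set ℕ) → ∀ x : ℝ, |iteratedDeriv m θ x| ≤ K * θ x) →
      ∀ (n : ℕ), 1 ≤ n → ∀ (S : Finset (Fin n × Fin n)), Admissible S →
      ∀ δ : ℝ, 0 < δ → ∀ e : ℝ, e = 1 ∨ e = -1 →
        ContDiff ℝ 3 (hSD θ S δ e) ∧
        (∀ x : Fin n → ℝ, 0 ≤ hSD θ S δ e x ∧ hSD θ S δ e x ≤ 1) ∧
        (∀ (x : Fin n → ℝ) (i : Fin n),
          |fderiv ℝ (hSD θ S δ e) x (Pi.single i 1)| ≤ C * ((n : ℝ) / δ) * hSD θ S δ e x) ∧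
        (∀ (x : Fin n → ℝ) (i j k : Fin n),
          |iteratedFDeriv ℝ 3 (hSD θ S δ e) x ![Pi.single i 1, Pi.single j 1, Pi.single k 1]|
            ≤ C * ((n : ℝ) / δ) ^ 3 * hSD θ S δ e x) := by
  refine ⟨44 * K ^ 3, ?_⟩
  intro θ h01 _ hθ _ hder n hn S _ δ hδ e _
  have hK0 : 0 ≤ K := by linarith
  have hK12 : K ≤ K ^ 2 := by nlinarith
  have hK23 : K ^ 2 ≤ K ^ 3 := by nlinarith [sq_nonneg K]
  have hn1 : (1 : ℝ) ≤ n := by exact_mod_cast hn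
  have hpos : ∀ y, 0 < θ y := fun y => (h01 y).1
  have hC : ContDiff ℝ 3 (hSD θ S δ e) := by
    unfold hSD
    apply contDiff_prod
    intro p _
    apply hθ.comp
    fun_prop
  have hnn : ∀ x, 0 ≤ hSD θ S δ e x := fun x => Finset.prod_nonneg fun p _ => (hpos _).le
  have hD : ∀ m : ℕ, m < 3 → ∀ y, HasDerivAt (iteratedDeriv m θ) (iteratedDeriv (m + 1) θ y) y := by
    intro m hm y
    rw [iteratedDeriv_succ]
    exact (ContDiff.differentiable_iteratedDeriv m hθ (by exact_mod_cast hm) y).hasDerivAt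
  have hD0 : ∀ y, HasDerivAt θ (iteratedDeriv 1 θ y) y := by
    intro y
    have := hD 0 (by norm_num) y
    rwa [iteratedDeriv_zero] at this
  -- logarithmic derivatives
  obtain ⟨a, ha⟩ : ∃ a : ℝ → ℝ, a = fun y => iteratedDeriv 1 θ y / θ y := ⟨_, rfl⟩
  obtain ⟨b, hb⟩ : ∃ b : ℝ → ℝ, b = fun y => iteratedDeriv 2 θ y / θ y := ⟨_, rfl⟩
  obtain ⟨c, hc⟩ : ∃ c : ℝ → ℝ, c = fun y => iteratedDeriv 3 θ y / θ y := ⟨_, rfl⟩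
  have bd : ∀ m : ℕ, m ∈ ({1, 2, 3} : Set ℕ) → ∀ y, |iteratedDeriv m θ y / θ y| ≤ K := by
    intro m hm y
    rw [abs_div, abs_of_pos (hpos y), div_le_iff₀ (hpos y)]
    exact hder m hm y
  have ba : ∀ y, |a y| ≤ K := fun y => by rw [ha]; exact bd 1 (by simp) y
  have bb : ∀ y, |b y| ≤ K := fun y => by rw [hb]; exact bd 2 (by simp) y
  have bc : ∀ y, |c y| ≤ K := fun y => by rw [hc]; exact bd 3 (by simp) y
  have da : ∀ y, HasDerivAt a (b y - a y ^ 2) y := by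
    intro y
    have := (hD 1 (by norm_num) y).div (hD0 y) (hpos y).ne'
    subst ha hb
    refine HasDerivAt.congr_deriv this ?_
    have := (hpos y).ne'
    field_simp
  have db : ∀ y, HasDerivAt b (c y - a y * b y) y := by
    intro y
    have := (hD 2 (by norm_num) y).div (hD0 y) (hpos y).ne'
    subst ha hb hc
    refine HasDerivAt.congr_deriv this ?_
    have := (hpos y).ne'
    field_simp
  obtain ⟨a1, ha1⟩ : ∃ a1 : ℝ → ℝ, a1 = fun y => b y - a y ^ 2 := ⟨_, rfl⟩
  obtain ⟨a2, ha2⟩ : ∃ a2 : ℝ → ℝ, a2 = fun y => c y - a y * b y - 2 * a y * a1 y := ⟨_, rfl⟩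
  have da' : ∀ y, HasDerivAt a (a1 y) y := by rw [ha1]; exact da
  have da1 : ∀ y, HasDerivAt a1 (a2 y) y := by
    intro y
    have := (db y).sub ((da' y).pow 2)
    rw [ha2]
    have h2 : a1 = b - a ^ 2 := by rw [ha1]; rfl
    rw [← h2] at this
    refine HasDerivAt.congr_deriv this ?_
    push_cast
    ring
  have ba1 : ∀ y, |a1 y| ≤ 2 * K ^ 2 := by
    intro y
    rw [ha1]
    have h1 := abs_sub (b y) (a y ^ 2)
    rw [abs_pow] at h1
    have h2 := pow_le_pow_left₀ (abs_nonneg _) (ba y) 2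
    have := bb y
    show |b y - a y ^ 2| ≤ _
    linarith
  have ba2 : ∀ y, |a2 y| ≤ 6 * K ^ 3 := by
    intro y
    rw [ha2]
    show |c y - a y * b y - 2 * a y * a1 y| ≤ _
    have h1 := abs_sub (c y - a y * b y) (2 * a y * a1 y)
    have h2 := abs_sub (c y) (a y * b y)
    rw [abs_mul] at h2
    rw [abs_mul (2 * a y), abs_mul 2, abs_two] at h1
    have h3 := mul_le_mul (ba y) (bb y) (abs_nonneg _) hK0
    have h4 := mul_le_mul (ba y) (ba1 y) (abs_nonneg _) hK0
    have := bc y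
    nlinarith
  have A1 : ∀ x v, HasLineDerivAt ℝ (hSD θ S δ e)
      (hSD θ S δ e x * ∑ p ∈ S, coef δ p v * a (arg δ e p x)) x v := by
    intro x v
    rw [ha]
    exact h_line S δ e θ _ hpos hD0 x v
  have N : (n : ℝ) / δ ≤ n ^ 3 / δ := by
    gcongr
    exact le_self_pow₀ hn1 (by norm_num)
  have hq : 0 < (n : ℝ) / δ := by positivity
  have hr : 0 < 1 / δ := by positivity
  have hqr : 1 / δ ≤ (n : ℝ) / δ := by gcongr
  have bA : ∀ x i, |∑ p ∈ S, coef δ p (Pi.single i 1) * a (arg δ e p x)| ≤ 2 * (n / δ) * K :=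
    fun x i => sum_bound S δ hδ i _ K fun p => ba _
  have bA1 : ∀ x i j, |∑ p ∈ S, coef δ p (Pi.single i 1) * coef δ p (Pi.single j 1)
      * a1 (arg δ e p x)| ≤ 4 * (n / δ) ^ 2 * K ^ 2 := by
    intro x i j
    have := sum_bound S δ hδ i (fun p => coef δ p (Pi.single j 1) * a1 (arg δ e p x))
      (n / δ * (2 * K ^ 2)) (fun p => by
        rw [abs_mul]
        exact mul_le_mul ((coef_le δ hδ p j).trans hqr) (ba1 _) (abs_nonneg _) hq.le)
    simp only [mul_assoc] at this ⊢
    refine this.trans (le_of_eq (by ring))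
  have bA2 : ∀ x i j k, |∑ p ∈ S, coef δ p (Pi.single i 1) * coef δ p (Pi.single j 1)
      * coef δ p (Pi.single k 1) * a2 (arg δ e p x)| ≤ 12 * (n / δ) ^ 3 * K ^ 3 := by
    intro x i j k
    have := sum_bound S δ hδ i (fun p => coef δ p (Pi.single j 1) *
      (coef δ p (Pi.single k 1) * a2 (arg δ e p x)))
      (n / δ * (n / δ * (6 * K ^ 3))) (fun p => by
        rw [abs_mul, abs_mul]
        refine mul_le_mul ((coef_le δ hδ p j).trans hqr) ?_ (by positivity) hq.le
        exact mul_le_mul ((coef_le δ hδ p k).trans hqr) (ba2 _) (abs_nonneg _) hq.le)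
    simp only [mul_assoc] at this ⊢
    refine this.trans (le_of_eq (by ring))
  refine ⟨hC, fun x => ⟨hnn x, Finset.prod_le_one (fun p _ => (hpos _).le) fun p _ => (h01 _).2.le⟩,
    ?_, ?_⟩
  · intro x i
    have hd : DifferentiableAt ℝ (hSD θ S δ e) x := (hC.differentiable (by norm_num)) x
    rw [← hd.lineDeriv_eq_fderiv, (A1 x _).lineDeriv, abs_mul, abs_of_nonneg (hnn x), mul_comm]
    refine mul_le_mul_of_nonneg_right ((bA x i).trans ?_) (hnn x)
    nlinarith [mul_le_mul_of_nonneg_left (hK12.trans hK23) hq.le, mul_nonneg hq.le (pow_nonneg hK0 3)]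
  · intro x i j k
    have e1 : ∀ y, iteratedFDeriv ℝ 1 (hSD θ S δ e) y ![Pi.single k 1] =
        hSD θ S δ e y * ∑ p ∈ S, coef δ p (Pi.single k 1) * a (arg δ e p y) := by
      intro y
      exact iter_step hC (m := 0) (by norm_num) _ (hSD θ S δ e) _ y (fun z => by simp) (A1 y _)
    have L1 : ∀ y (u v : Fin n → ℝ),
        HasLineDerivAt ℝ (fun y => ∑ p ∈ S, coef δ p u * a (arg δ e p y))
          (∑ p ∈ S, coef δ p u * coef δ p v * a1 (arg δ e p y)) y v := fun y u v =>
      sum_line S δ e a a1 da' (fun p => coef δ p u) y v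
    have L2 : ∀ y (u v w : Fin n → ℝ),
        HasLineDerivAt ℝ (fun y => ∑ p ∈ S, coef δ p u * coef δ p v * a1 (arg δ e p y))
          (∑ p ∈ S, coef δ p u * coef δ p v * coef δ p w * a2 (arg δ e p y)) y w :=
      fun y u v w => sum_line S δ e a1 a2 da1 (fun p => coef δ p u * coef δ p v) y w
    have e2 : ∀ y, iteratedFDeriv ℝ 2 (hSD θ S δ e) y ![Pi.single j 1, Pi.single k 1] =
        (hSD θ S δ e y * ∑ p ∈ S, coef δ p (Pi.single j 1) * a (arg δ e p y)) *
          (∑ p ∈ S, coef δ p (Pi.single k 1) * a (arg δ e p y)) +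
        hSD θ S δ e y *
          ∑ p ∈ S, coef δ p (Pi.single k 1) * coef δ p (Pi.single j 1) * a1 (arg δ e p y) := by
      intro y
      exact iter_step hC (m := 1) (by norm_num) ![Pi.single j 1, Pi.single k 1] _ _ y
        e1 (mul_line (A1 y _) (L1 y _ _))
    have e3 := iter_step hC (m := 2) (by norm_num)
      ![Pi.single i 1, Pi.single j 1, Pi.single k 1] _ _ x e2
      (add_line (mul_line (mul_line (A1 x _) (L1 x _ _)) (L1 x _ _))
        (mul_line (A1 x _) (L2 x _ _ _)))
    have e3' := e3
    simp only [Matrix.cons_val_zero] at e3'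
    rw [e3']
    have p1 := bA x i
    have p2 := bA x j
    have p3 := bA x k
    have q1 := bA1 x j i
    have q2 := bA1 x k i
    have q3 := bA1 x k j
    have r := bA2 x k j i
    have hh := hnn x
    generalize hSD θ S δ e x = H at *
    generalize ∑ p ∈ S, coef δ p (Pi.single i 1) * a (arg δ e p x) = X1 at *
    generalize ∑ p ∈ S, coef δ p (Pi.single j 1) * a (arg δ e p x) = X2 at *
    generalize ∑ p ∈ S, coef δ p (Pi.single k 1) * a (arg δ e p x) = X3 at *
    generalize ∑ p ∈ S, coef δ p (Pi.single j 1) * coef δ p (Pi.single i 1) * a1 (arg δ e p x) = Y1 at *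
    generalize ∑ p ∈ S, coef δ p (Pi.single k 1) * coef δ p (Pi.single i 1) * a1 (arg δ e p x) = Y2 at *
    generalize ∑ p ∈ S, coef δ p (Pi.single k 1) * coef δ p (Pi.single j 1) * a1 (arg δ e p x) = Y3 at *
    generalize ∑ p ∈ S, coef δ p (Pi.single k 1) * coef δ p (Pi.single j 1) * coef δ p (Pi.single i 1)
      * a2 (arg δ e p x) = Z at *
    generalize (n : ℝ) / δ = q at *
    have s0 : |X1 * X2 * X3| ≤ (2 * q * K) * (2 * q * K) * (2 * q * K) := by
      rw [abs_mul, abs_mul]; gcongr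
    have s1 : |Y1 * X3| ≤ (4 * q ^ 2 * K ^ 2) * (2 * q * K) := by
      rw [abs_mul]; gcongr
    have s2 : |X2 * Y2| ≤ (2 * q * K) * (4 * q ^ 2 * K ^ 2) := by
      rw [abs_mul]; gcongr
    have s3 : |X1 * Y3| ≤ (2 * q * K) * (4 * q ^ 2 * K ^ 2) := by
      rw [abs_mul]; gcongr
    have t : |X1 * X2 * X3 + Y1 * X3 + X2 * Y2 + X1 * Y3 + Z| ≤ 44 * K ^ 3 * q ^ 3 := by
      rw [abs_le] at *
      constructor <;> linarith
    calc _ = |H * (X1 * X2 * X3 + Y1 * X3 + X2 * Y2 + X1 * Y3 + Z)| := by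
          congr 1; ring
      _ = |X1 * X2 * X3 + Y1 * X3 + X2 * Y2 + X1 * Y3 + Z| * H := by
          rw [abs_mul, abs_of_nonneg hh, mul_comm]
      _ ≤ _ := mul_le_mul_of_nonneg_right t hh
end

section
/- Let θ : ℝ → (0,1) be an increasing, three times continuously differentiable function for which there is a constant K ≥ 1 with θ(−x) ≤ K e^{−x} and 1 − θ(x) ≤ K e^{−x} for all x ≥ 0, and |θ^{(m)}(x)| ≤ K θ(x) for all x ∈ ℝ and m = 1,2,3. Let n ≥ 1, let S ⊆ {1,…,n}×{1,…,n} be admissible, and let δ > 0 satisfy e^{−1/√δ} ≤ 1/n². Then there is a constant C depending only on K such that for all (x₁,…,xₙ) ∈ ℝⁿ: h_{S,δ}^{−}(x₁,…,xₙ) − C e^{−1/√δ} ≤ 𝟏_{R(S)}(x₁,…,xₙ) ≤ h_{S,δ}^{+}(x₁,…,xₙ) + C n² e^{−1/√δ}. -/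
theorem prod_ge_aux {ι : Type*} (S : Finset ι) (f : ι → ℝ) (ε : ℝ)
    (h0 : ∀ p ∈ S, 0 ≤ f p) (h1 : ∀ p ∈ S, f p ≤ 1) (h2 : ∀ p ∈ S, 1 - ε ≤ f p) :
    1 - (S.card : ℝ) * ε ≤ ∏ p ∈ S, f p := by
  classical
  induction S using Finset.induction_on with
  | empty => simp
  | insert a s ha ih =>
    have ih' := ih (fun p hp => h0 p (Finset.mem_insert_of_mem hp))
      (fun p hp => h1 p (Finset.mem_insert_of_mem hp))
      (fun p hp => h2 p (Finset.mem_insert_of_mem hp))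
    have hle : ∏ p ∈ s, f p ≤ 1 := Finset.prod_le_one
      (fun p hp => h0 p (Finset.mem_insert_of_mem hp))
      (fun p hp => h1 p (Finset.mem_insert_of_mem hp))
    have a1 := h1 a (Finset.mem_insert_self a s)
    have a2 := h2 a (Finset.mem_insert_self a s)
    rw [Finset.prod_insert ha, Finset.card_insert_of_notMem ha]
    push_cast
    nlinarith [mul_nonneg (sub_nonneg.2 a1) (sub_nonneg.2 hle)]

theorem smooth_test_function_indicator (K : ℝ) (hK : 1 ≤ K) :
    ∃ C : ℝ, ∀ θ : ℝ → ℝ,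
      (∀ x : ℝ, 0 < θ x ∧ θ x < 1) →
      Monotone θ →
      ContDiff ℝ 3 θ →
      (∀ x : ℝ, 0 ≤ x → θ (-x) ≤ K * Real.exp (-x) ∧ 1 - θ x ≤ K * Real.exp (-x)) →
      (∀ m : ℕ, m ∈ ({1, 2, 3} : Set ℕ) → ∀ x : ℝ, |iteratedDeriv m θ x| ≤ K * θ x) →
      ∀ (n : ℕ), 1 ≤ n → ∀ (S : Finset (Fin n × Fin n)), Admissible S →
      ∀ δ : ℝ, 0 < δ → Real.exp (-1 / Real.sqrt δ) ≤ 1 / (n : ℝ) ^ 2 →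
      ∀ x : Fin n → ℝ,
        hSD θ S δ (-1) x - C * Real.exp (-1 / Real.sqrt δ)
            ≤ (if ∀ p ∈ S, x p.2 < x p.1 then (1 : ℝ) else 0) ∧
        (if ∀ p ∈ S, x p.2 < x p.1 then (1 : ℝ) else 0)
            ≤ hSD θ S δ 1 x + C * (n : ℝ) ^ 2 * Real.exp (-1 / Real.sqrt δ) := by
  refine ⟨K, ?_⟩
  intro θ hθ hmono _ hdec _ n _ S _ δ hδ _ x
  have hs : 0 < Real.sqrt δ := Real.sqrt_pos.2 hδ
  have hdiv : Real.sqrt δ / δ = 1 / Real.sqrt δ := by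
    rw [div_eq_div_iff hδ.ne' hs.ne', one_mul, Real.mul_self_sqrt hδ.le]
  have hpos : 0 ≤ 1 / Real.sqrt δ := by positivity
  obtain ⟨hd1, hd2⟩ := hdec _ hpos
  have hneg : -(1 / Real.sqrt δ) = -1 / Real.sqrt δ := by ring
  rw [hneg] at hd1 hd2
  set E := Real.exp (-1 / Real.sqrt δ) with hE
  have hEpos : 0 < E := Real.exp_pos _
  have hKE : 0 ≤ K * E := by positivity
  constructor
  · split_ifs with h
    · have : hSD θ S δ (-1) x ≤ 1 :=
        Finset.prod_le_one (fun p _ => (hθ _).1.le) (fun p _ => (hθ _).2.le)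
      linarith
    · push Not at h
      obtain ⟨p, hp, hle⟩ := h
      have h1 : hSD θ S δ (-1) x ≤ θ ((x p.1 - x p.2 + (-1) * Real.sqrt δ) / δ) := by
        classical
        unfold hSD
        rw [← Finset.mul_prod_erase S _ hp]
        exact mul_le_of_le_one_right (hθ _).1.le
          (Finset.prod_le_one (fun p _ => (hθ _).1.le) (fun p _ => (hθ _).2.le))
      have h2 : (x p.1 - x p.2 + (-1) * Real.sqrt δ) / δ ≤ -1 / Real.sqrt δ := by
        rw [← hneg, ← hdiv, ← neg_div]
        exact div_le_div_of_nonneg_right (by linarith) hδ.le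
      have h3 := hmono h2
      linarith
  · split_ifs with h
    · have h1 : 1 - (S.card : ℝ) * (K * E) ≤ hSD θ S δ 1 x := by
        refine prod_ge_aux S _ _ (fun p _ => (hθ _).1.le) (fun p _ => (hθ _).2.le) ?_
        intro p hp
        have h2 : 1 / Real.sqrt δ ≤ (x p.1 - x p.2 + 1 * Real.sqrt δ) / δ := by
          rw [← hdiv]
          exact div_le_div_of_nonneg_right (by linarith [h p hp]) hδ.le
        have h3 := hmono h2
        linarith
      have hc : (S.card : ℝ) ≤ (n : ℝ) ^ 2 := by
        have := Finset.card_le_univ S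
        rw [Fintype.card_prod, Fintype.card_fin, ← sq] at this
        exact_mod_cast this
      nlinarith [mul_le_mul_of_nonneg_right hc hKE]
    · have : 0 ≤ hSD θ S δ 1 x := Finset.prod_nonneg (fun p _ => (hθ _).1.le)
      have : 0 ≤ K * (n : ℝ) ^ 2 * E := by positivity
      linarith
end

section
/- Let C₁, C₃ ≥ 1 and let h : ℝⁿ → [0,∞) be three times continuously differentiable with h(x) ≤ 1, sup_{1≤i≤n} |∂h(x)/∂x_i| ≤ C₁ h(x), and sup_{1≤i,j,k≤n} |∂³h(x)/(∂x_i∂x_j∂x_k)| ≤ C₃ h(x) for all x ∈ ℝⁿ. There is an absolute constant K such that the following holds. Let 0 < ε ≤ min{1/(2C₁), 1/(2C₃^{1/3})}, let Y ∈ ℝⁿ be fixed, let X = (X₁,…,Xₙ) be a random vector whose components have mean zero and finite third absolute moments, and let Z = (Z₁,…,Zₙ) be a multivariate normal random vector whose components have mean zero and the same covariances r_{i,j} := 𝔼[X_i X_j] as X. Then there exists a real number γ with |γ| ≤ 6 C₃ ε³ such that |𝔼 h(Y+X) − (1+γ) 𝔼 h(Y+Z)| ≤ K C₃ ( ∑_{i=1}^{n}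 𝔼[𝟏_{|X_i| > ε/n} (ε³ + n² |X_i|³)] + ∑_{i=1}^{n} (ε³ + n² r_{i,i}^{3/2}) e^{−ε²/(2 n² r_{i,i})} ), with the convention that e^{−ε²/(2 n² r_{i,i})} := 0 when r_{i,i} = 0. -/
open MeasureTheory ProbabilityTheory

/-- `Z` is a centered (multivariate) Gaussian random vector with covariance matrix `C`:
every linear combination `∑ i, t i * Z i` is a centered real Gaussian with variance
`∑ i, ∑ j, t i * t j * C i j`. -/
def IsCenteredGaussianVector {Ω : Type*} [MeasurableSpace Ω] (μ : Measure Ω)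
    {n : ℕ} (Z : Fin n → Ω → ℝ) (C : Fin n → Fin n → ℝ) : Prop :=
  ∀ t : Fin n → ℝ,
    Measure.map (fun ω => ∑ i, t i * Z i ω) μ =
      gaussianReal 0 (∑ i, ∑ j, t i * t j * C i j).toNNReal


lemma ls_expand {n m : ℕ} (f : ContinuousMultilinearMap ℝ (fun _ : Fin m => (Fin n → ℝ)) ℝ)
    (v : Fin n → ℝ) :
    f (fun _ => v) = ∑ r : Fin m → Fin n, (∏ k, v (r k)) * f (fun k => Pi.single (r k) 1) := by
  have hv : v = ∑ j, v j • (Pi.single j (1 : ℝ) : Fin n → ℝ) := by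
    ext k
    simp [Finset.sum_apply, Pi.single_apply]
  have h1 := f.toMultilinearMap.map_sum
    (fun (_ : Fin m) (j : Fin n) => v j • (Pi.single j (1 : ℝ) : Fin n → ℝ))
  rw [← hv] at h1
  refine h1.trans (Finset.sum_congr rfl fun r _ => ?_)
  have := f.toMultilinearMap.map_smul_univ (fun k => v (r k))
    (fun k => (Pi.single (r k) (1 : ℝ) : Fin n → ℝ))
  simpa using this

lemma ls_third {n : ℕ} (f : ContinuousMultilinearMap ℝ (fun _ : Fin 3 => (Fin n → ℝ)) ℝ)
    (v : Fin n → ℝ) (c : ℝ)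
    (hc : ∀ i j k, |f ![Pi.single i 1, Pi.single j 1, Pi.single k 1]| ≤ c) :
    |f (fun _ => v)| ≤ c * (∑ i, |v i|) ^ 3 := by
  rw [ls_expand]
  have h3 : (∑ i, |v i|) ^ 3 = ∑ r : Fin 3 → Fin n, ∏ k, |v (r k)| := by
    have := Finset.prod_univ_sum (fun _ : Fin 3 => (Finset.univ : Finset (Fin n)))
      (fun _ i => |v i|)
    simpa using this
  rw [h3, Finset.mul_sum]
  refine (Finset.abs_sum_le_sum_abs _ _).trans (Finset.sum_le_sum fun r _ => ?_)
  rw [abs_mul, Finset.abs_prod, mul_comm]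
  refine mul_le_mul_of_nonneg_right ?_ (Finset.prod_nonneg fun _ _ => abs_nonneg _)
  have := hc (r 0) (r 1) (r 2)
  have he : (fun k => (Pi.single (r k) 1 : Fin n → ℝ))
      = ![Pi.single (r 0) 1, Pi.single (r 1) 1, Pi.single (r 2) 1] := by
    funext k
    fin_cases k <;> rfl
  rwa [he]

lemma ls_taylor {n : ℕ} {C₃ : ℝ} {h : (Fin n → ℝ) → ℝ} (hC : 1 ≤ C₃)
    (hh : ContDiff ℝ 3 h)
    (h3 : ∀ (x : Fin n → ℝ) (i j k : Fin n),
          |iteratedFDeriv ℝ 3 h x ![Pi.single i 1, Pi.single j 1, Pi.single k 1]| ≤ C₃ * h x)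
    (Y : Fin n → ℝ) :
    ∃ (L : Fin n → ℝ) (H : Fin n → Fin n → ℝ), ∀ (x : Fin n → ℝ) (M : ℝ),
      (∀ t ∈ Set.Icc (0:ℝ) 1, h (Y + t • x) ≤ M) →
      |h (Y + x) - (h Y + ∑ i, L i * x i + ∑ i, ∑ j, H i j * (x i * x j))|
        ≤ C₃ * M * (∑ i, |x i|) ^ 3 / 2 := by
  refine ⟨fun i => fderiv ℝ h Y (Pi.single i 1),
    fun i j => (1/2) * iteratedFDeriv ℝ 2 h Y ![Pi.single i 1, Pi.single j 1], fun x M hM => ?_⟩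
  have ht := map_add_eq_sum_add_integral_iteratedFDeriv (n := 2) (f := h) (x := Y) (y := x)
    (fun t _ => by exact_mod_cast hh.contDiffAt)
  have hint : ‖∫ t in (0:ℝ)..1, (1 - t)^2 • iteratedFDeriv ℝ (2 + 1) h (Y + t • x) (fun _ ↦ x)‖
      ≤ (C₃ * M * (∑ i, |x i|) ^ 3) * |1 - 0| := by
    refine intervalIntegral.norm_integral_le_of_norm_le_const fun t ht => ?_
    rw [Set.uIoc_of_le zero_le_one] at ht
    rw [norm_smul, Real.norm_eq_abs, Real.norm_eq_abs]
    have h1 : |iteratedFDeriv ℝ 3 h (Y + t • x) (fun _ ↦ x)|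
      ≤ C₃ * h (Y + t • x) * (∑ i, |x i|) ^ 3 := ls_third _ _ _ (h3 _)
    have h2 := hM t ⟨ht.1.le, ht.2⟩
    have h4 : |(1 - t)^2| ≤ 1 := by
      rw [abs_le]; constructor <;> nlinarith [ht.1, ht.2]
    have h5 : (0:ℝ) ≤ (∑ i, |x i|) ^ 3 := by positivity
    calc _ ≤ 1 * |iteratedFDeriv ℝ 3 h (Y + t • x) (fun _ ↦ x)| :=
          mul_le_mul_of_nonneg_right h4 (abs_nonneg _)
      _ ≤ _ := by
        rw [one_mul]
        refine h1.trans ?_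
        gcongr
  have hL : fderiv ℝ h Y x = ∑ i, fderiv ℝ h Y (Pi.single i 1) * x i := by
    have := ls_expand (iteratedFDeriv ℝ 1 h Y) x
    simp only [iteratedFDeriv_one_apply] at this
    rw [this]
    rw [← (Equiv.funUnique (Fin 1) (Fin n)).symm.sum_comp]
    simp [mul_comm]
  have hH : iteratedFDeriv ℝ 2 h Y (fun _ => x) = ∑ i, ∑ j,
      iteratedFDeriv ℝ 2 h Y ![Pi.single i 1, Pi.single j 1] * (x i * x j) := by
    rw [ls_expand, ← (finTwoArrowEquiv (Fin n)).symm.sum_comp, Fintype.sum_prod_type]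
    refine Finset.sum_congr rfl fun i _ => Finset.sum_congr rfl fun j _ => ?_
    rw [mul_comm]
    congr 1
    · congr 1
      ext k : 1
      fin_cases k <;> rfl
    · simp [Fin.prod_univ_two, finTwoArrowEquiv]
  simp only [Finset.sum_range_succ, Finset.range_zero, Finset.sum_empty, Nat.factorial,
    iteratedFDeriv_zero_apply, iteratedFDeriv_one_apply, hL, hH] at ht
  rw [ht]
  rw [Real.norm_eq_abs] at hint
  simp only [sub_zero, abs_one, mul_one] at hint
  simp only [smul_eq_mul, mul_assoc, ← Finset.mul_sum] at hint ⊢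
  norm_num
  linarith

lemma ls_growth {n : ℕ} {C₁ : ℝ} {h : (Fin n → ℝ) → ℝ}
    (hh : ContDiff ℝ 3 h)
    (h1 : ∀ (x : Fin n → ℝ) (i : Fin n), |fderiv ℝ h x (Pi.single i 1)| ≤ C₁ * h x)
    (Y v : Fin n → ℝ) :
    h (Y + v) ≤ Real.exp (C₁ * ∑ i, |v i|) * h Y := by
  set c := C₁ * ∑ i, |v i|
  have hd : Differentiable ℝ h := hh.differentiable (by norm_num)
  have hL : ∀ x, |fderiv ℝ h x v| ≤ c * h x := by
    intro x
    have hv : v = ∑ j, v j • (Pi.single j (1 : ℝ) : Fin n → ℝ) := by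
      ext k
      simp [Finset.sum_apply, Pi.single_apply]
    conv_lhs => rw [hv]
    rw [map_sum]
    refine (Finset.abs_sum_le_sum_abs _ _).trans ?_
    simp only [c, Finset.mul_sum, Finset.sum_mul]
    refine Finset.sum_le_sum fun i _ => ?_
    rw [map_smul, smul_eq_mul, abs_mul]
    nlinarith [h1 x i, abs_nonneg (v i)]
  let g : ℝ → ℝ := fun t => Real.exp (-(c * t)) * h (Y + t • v)
  have hg : ∀ t, HasDerivAt g (Real.exp (-(c * t)) * (-c) * h (Y + t • v)
      + Real.exp (-(c * t)) * fderiv ℝ h (Y + t • v) v) t := by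
    intro t
    refine HasDerivAt.mul ?_ ?_
    · have : HasDerivAt (fun t : ℝ => -(c * t)) (-c) t := by
        have h2 := ((hasDerivAt_id t).const_mul c).neg
        rw [mul_one] at h2
        exact h2
      exact this.exp
    · have := (hd (Y + t • v)).hasFDerivAt.comp_hasDerivAt t
        (((hasDerivAt_id t).smul_const v).const_add Y)
      rw [one_smul] at this
      exact this
  have ha : Antitone g := antitone_of_hasDerivAt_nonpos hg (fun t => by
    have := (abs_le.1 (hL (Y + t • v))).2
    have h2 := mul_le_mul_of_nonneg_left this (Real.exp_pos (-(c*t))).le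
    simp only [Pi.zero_apply]
    linarith)
  have := ha zero_le_one
  simp only [g] at this
  simp at this
  rw [Real.exp_neg] at this
  rwa [inv_mul_le_iff₀ (Real.exp_pos _)] at this

/-- tail functional -/
noncomputable def lsT (n : ℕ) (ε x : ℝ) : ℝ :=
  if ε / n < |x| then ε ^ 3 + (n : ℝ) ^ 2 * |x| ^ 3 else 0

lemma lsT_nonneg (n : ℕ) {ε : ℝ} (hε : 0 < ε) (x : ℝ) : 0 ≤ lsT n ε x := by
  unfold lsT; split_ifs <;> positivity

lemma ls_sum_small {n : ℕ} {ε : ℝ} (hε : 0 < ε) {x : Fin n → ℝ} (hx : ∀ i, |x i| ≤ ε / n) :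
    ∑ i, |x i| ≤ ε := by
  rcases Nat.eq_zero_or_pos n with rfl | hn
  · simpa using hε.le
  calc ∑ i, |x i| ≤ ∑ _i : Fin n, ε / n := Finset.sum_le_sum fun i _ => hx i
    _ = ε := by
      have : (n:ℝ) ≠ 0 := by positivity
      simp; field_simp

lemma ls_large {n : ℕ} {ε : ℝ} (hε : 0 < ε) {x : Fin n → ℝ} (hx : ¬ ∀ i, |x i| ≤ ε / n) :
    (∑ i, |x i|) ^ 3 ≤ ∑ i, lsT n ε (x i) := by
  push Not at hx
  obtain ⟨i₀, hi₀⟩ := hx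
  have hn : 0 < n := i₀.pos
  have hn' : (0:ℝ) < n := by positivity
  have h1 : (∑ i, |x i|) ^ 3 ≤ (n:ℝ)^2 * ∑ i, |x i| ^ 3 := by
    have := pow_sum_div_card_le_sum_pow (s := (Finset.univ : Finset (Fin n))) (f := fun i => |x i|) (fun i _ => abs_nonneg _) 2
    rw [div_le_iff₀ (by simp; positivity)] at this
    simpa [mul_comm] using this
  refine h1.trans ?_
  have h2 : ∀ i, (n:ℝ)^2 * |x i|^3 ≤ lsT n ε (x i) - (if i = i₀ then ε^3 else 0) + ε^3 / n := by
    intro i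
    have hp : 0 < ε^3 / n := by positivity
    by_cases hi : ε / n < |x i|
    · simp only [lsT, hi, if_true]
      split_ifs <;> nlinarith [pow_pos hε 3]
    · have hne : i ≠ i₀ := by rintro rfl; exact hi hi₀
      simp only [lsT, hi, if_false, hne]
      push Not at hi
      have := pow_le_pow_left₀ (abs_nonneg _) hi 3
      calc _ ≤ (n:ℝ)^2 * (ε/n)^3 := by gcongr
        _ = _ := by field_simp; simp
  rw [Finset.mul_sum]
  refine (Finset.sum_le_sum fun i _ => h2 i).trans ?_
  rw [Finset.sum_add_distrib, Finset.sum_sub_distrib]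
  simp
  field_simp
  simp

noncomputable def lsM : ℝ := ∫ x, |x| ^ 3 ∂(gaussianReal 0 1)

lemma lsM_nonneg : 0 ≤ lsM := integral_nonneg fun x => by positivity

lemma ls_int_abs3 (v : NNReal) : Integrable (fun x : ℝ => |x| ^ 3) (gaussianReal 0 v) := by
  have := (memLp_id_gaussianReal (μ := 0) (v := v) 3).integrable_norm_pow (by norm_num)
  simpa using this

lemma ls_pdf (x : ℝ) : gaussianPDFReal 0 1 x = (√(2 * Real.pi))⁻¹ * Real.exp (-x^2/2) := by
  simp [gaussianPDFReal]

lemma ls_gauss_std {A B b : ℝ} (hA : 0 ≤ A) (hB : 0 ≤ B) (hb : 0 ≤ b) :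
    ∫ x, (if b < |x| then A + B * |x| ^ 3 else 0) ∂(gaussianReal 0 1)
      ≤ 2 * Real.exp (-b^2/2) * (A + 4 * B * (b^3 + lsM)) := by
  rw [integral_gaussianReal_eq_integral_smul one_ne_zero]
  let f : ℝ → ℝ := fun y => gaussianPDFReal 0 1 y * (if b < y then A + B * y ^ 3 else 0)
  have e1 : ∀ x : ℝ, gaussianPDFReal 0 1 x • (if b < |x| then A + B * |x| ^ 3 else 0) = f |x| := by
    intro x
    simp [f, ls_pdf]
  simp_rw [e1]
  rw [integral_comp_abs, ← integral_indicator measurableSet_Ioi,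
    ← integral_add_right_eq_self _ b, mul_assoc]
  refine mul_le_mul_of_nonneg_left ?_ zero_le_two
  have hi : Integrable (fun x : ℝ => A + 4 * B * (b^3 + |x|^3)) (gaussianReal 0 1) :=
    (integrable_const _).add (((integrable_const _).add (ls_int_abs3 1)).const_mul _)
  have e2 : ∫ x, (A + 4 * B * (b^3 + |x|^3)) ∂(gaussianReal 0 1) = A + 4 * B * (b^3 + lsM) := by
    have i1 : Integrable (fun x : ℝ => b^3 + |x|^3) (gaussianReal 0 1) :=
      (integrable_const _).add (ls_int_abs3 1)
    rw [integral_add (integrable_const _) (i1.const_mul _), integral_const_mul,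
      integral_add (integrable_const _) (ls_int_abs3 1)]
    simp [lsM]
  have hi2 : Integrable (fun x : ℝ => gaussianPDFReal 0 1 x • (A + 4 * B * (b^3 + |x|^3))) := by
    rw [gaussianReal_of_var_ne_zero _ one_ne_zero] at hi
    have := (integrable_withDensity_iff_integrable_smul₀' (measurable_gaussianPDF 0 1).aemeasurable
      (ae_of_all _ fun x => gaussianPDF_lt_top)).1 hi
    simpa [toReal_gaussianPDF] using this
  rw [← e2, integral_gaussianReal_eq_integral_smul one_ne_zero, ← integral_const_mul]
  refine integral_mono_of_nonneg (ae_of_all _ fun x => ?_) (hi2.const_mul _)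
    (ae_of_all _ fun x => ?_)
  · refine Set.indicator_nonneg (fun y hy => ?_) _
    have hy' : 0 < y := hy
    refine mul_nonneg (gaussianPDFReal_nonneg _ _ _) ?_
    split_ifs <;> positivity
  · have hr : 0 ≤ Real.exp (-b^2/2) * (gaussianPDFReal 0 1 x • (A + 4 * B * (b^3 + |x|^3))) :=
      mul_nonneg (Real.exp_pos _).le (mul_nonneg (gaussianPDFReal_nonneg _ _ _) (by positivity))
    by_cases hx : 0 < x
    · have h0 : x + b ∈ Set.Ioi (0:ℝ) := by simp; linarith
      have h1 : b < x + b := by linarith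
      simp only [Set.indicator_of_mem h0, f, h1, if_true, smul_eq_mul]
      rw [ls_pdf, ls_pdf]
      have h2 : Real.exp (-(x+b)^2/2) ≤ Real.exp (-b^2/2) * Real.exp (-x^2/2) := by
        rw [← Real.exp_add]
        apply Real.exp_le_exp.2
        nlinarith [mul_nonneg hx.le hb]
      have h3 : (x+b)^3 ≤ 4 * (b^3 + |x|^3) := by
        rw [abs_of_pos hx]
        nlinarith [mul_nonneg (add_nonneg hx.le hb) (sq_nonneg (x - b))]
      calc _ ≤ (√(2 * Real.pi))⁻¹ * (Real.exp (-b^2/2) * Real.exp (-x^2/2)) *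
            (A + B * (4 * (b^3 + |x|^3))) := by gcongr
        _ = _ := by ring
    · refine le_trans (le_of_eq ?_) hr
      refine Set.indicator_apply_eq_zero.2 fun _ => ?_
      have : ¬ b < x + b := by linarith
      simp [f, this]

lemma ls_gauss {n : ℕ} (hn : 0 < n) {ε r : ℝ} (hε : 0 < ε) (hr : 0 ≤ r) :
    ∫ x, lsT n ε x ∂(gaussianReal 0 r.toNNReal) ≤
      (10 + 8 * lsM) * ((ε ^ 3 + (n : ℝ) ^ 2 * r ^ ((3 : ℝ) / 2)) *
               (if r = 0 then 0
                else Real.exp (-(ε ^ 2 / (2 * (n : ℝ) ^ 2 * r))))) := by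
  have hn' : (1:ℝ) ≤ n := by exact_mod_cast hn
  by_cases h0 : r = 0
  · subst h0
    have : ¬ (ε / n < 0) := by
      have : 0 < ε / n := by positivity
      linarith
    simp [gaussianReal_zero_var, lsT, this]
  have hr' : 0 < r := lt_of_le_of_ne hr (Ne.symm h0)
  rw [if_neg h0]
  set s := √r with hs
  have hs0 : 0 < s := Real.sqrt_pos.2 hr'
  have hss : s^2 = r := Real.sq_sqrt hr
  have hg : gaussianReal 0 r.toNNReal = (gaussianReal 0 1).map (s * ·) := by
    rw [gaussianReal_map_const_mul]
    congr 1
    · simp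
    · ext
      simp [hss, hr]
  have hms : Measurable (lsT n ε) := by
    unfold lsT
    refine Measurable.ite (measurableSet_lt measurable_const (by fun_prop)) (by fun_prop)
      (by fun_prop)
  rw [hg, integral_map (by fun_prop) hms.aestronglyMeasurable]
  have e1 : ∀ x, lsT n ε (s * x) =
      if ε / n / s < |x| then ε^3 + ((n:ℝ)^2 * s^3) * |x|^3 else 0 := by
    intro x
    unfold lsT
    simp only [abs_mul, abs_of_pos hs0, div_lt_iff₀ hs0, mul_comm s]
    split_ifs
    · ring
    · rfl
  simp_rw [e1]
  have e3 : r ^ ((3 : ℝ) / 2) = s^3 := by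
    rw [hs, Real.sqrt_eq_rpow, ← Real.rpow_natCast, ← Real.rpow_mul hr]
    norm_num
  refine (ls_gauss_std (by positivity) (by positivity) (by positivity)).trans ?_
  have e4 : -(ε / n / s)^2 / 2 = -(ε ^ 2 / (2 * (n : ℝ) ^ 2 * r)) := by
    rw [← hss]
    field_simp
  rw [e4, e3]
  have e5 : (n:ℝ)^2 * s^3 * (ε / n / s)^3 ≤ ε^3 := by
    have : (n:ℝ)^2 * s^3 * (ε / n / s)^3 = ε^3 / n := by
      field_simp
    rw [this]
    exact div_le_self (by positivity) hn'
  have hE := Real.exp_pos (-(ε ^ 2 / (2 * (n : ℝ) ^ 2 * r)))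
  have hm := lsM_nonneg
  have h6 : ε ^ 3 + 4 * ((n:ℝ)^2 * s^3) * ((ε / n / s)^3 + lsM) ≤
      (5 + 4 * lsM) * (ε^3 + (n:ℝ)^2 * s^3) := by
    have a1 : 0 ≤ lsM * ε^3 := by positivity
    have a2 : 0 ≤ (n:ℝ)^2 * s^3 := by positivity
    nlinarith
  calc _ ≤ 2 * Real.exp (-(ε ^ 2 / (2 * (n : ℝ) ^ 2 * r))) *
        ((5 + 4 * lsM) * (ε^3 + (n:ℝ)^2 * s^3)) := by gcongr
    _ = _ := by ring

lemma lsT_measurable (n : ℕ) (ε : ℝ) : Measurable (lsT n ε) := by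
  unfold lsT
  exact Measurable.ite (measurableSet_lt measurable_const (by fun_prop)) (by fun_prop)
    (by fun_prop)

section prob
variable {Ω : Type} {mΩ : MeasurableSpace Ω} {P : Measure Ω} [IsProbabilityMeasure P]

lemma lsT_integrable {n : ℕ} {ε : ℝ} (hε : 0 < ε) {W : Ω → ℝ} (hm : AEMeasurable W P)
    (h3 : Integrable (fun ω => |W ω| ^ 3) P) : Integrable (fun ω => lsT n ε (W ω)) P := by
  refine Integrable.mono' ((integrable_const (ε^3)).add (h3.const_mul ((n:ℝ)^2)))
    ((lsT_measurable n ε).comp_aemeasurable hm).aestronglyMeasurable (ae_of_all _ fun ω => ?_)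
  rw [Real.norm_eq_abs, abs_of_nonneg (lsT_nonneg n hε _)]
  unfold lsT
  simp only [Pi.add_apply]
  split_ifs
  · exact le_rfl
  · positivity

lemma ls_int_prod {U V : Ω → ℝ} (hU : AEMeasurable U P) (hV : AEMeasurable V P)
    (hU3 : Integrable (fun ω => |U ω| ^ 3) P) (hV3 : Integrable (fun ω => |V ω| ^ 3) P) :
    Integrable (fun ω => U ω * V ω) P := by
  refine Integrable.mono' (((integrable_const (2:ℝ)).add hU3).add hV3)
    (hU.mul hV).aestronglyMeasurable (ae_of_all _ fun ω => ?_)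
  rw [Real.norm_eq_abs, abs_mul]
  simp only [Pi.add_apply]
  have key : ∀ a : ℝ, 0 ≤ a → a^2 ≤ 1 + a^3 := by
    intro a ha
    rcases le_total a 1 with h | h
    · nlinarith [pow_nonneg ha 3]
    · nlinarith [mul_nonneg (sq_nonneg a) (sub_nonneg.2 h)]
  have k1 := key _ (abs_nonneg (U ω))
  have k2 := key _ (abs_nonneg (V ω))
  nlinarith [sq_nonneg (|U ω| - |V ω|), sq_nonneg (|U ω|), sq_nonneg (|V ω|)]

lemma ls_int_h {n : ℕ} {h : (Fin n → ℝ) → ℝ} (hh : ContDiff ℝ 3 h)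
    (hb : ∀ x, 0 ≤ h x ∧ h x ≤ 1) (Y : Fin n → ℝ) {W : Fin n → Ω → ℝ}
    (hW : ∀ i, AEMeasurable (W i) P) : Integrable (fun ω => h (fun i => Y i + W i ω)) P := by
  refine Integrable.mono' (integrable_const (1:ℝ)) ?_ (ae_of_all _ fun ω => ?_)
  · refine (hh.continuous.measurable.comp_aemeasurable ?_).aestronglyMeasurable
    exact aemeasurable_pi_lambda _ fun i => (hW i).const_add _
  · rw [Real.norm_eq_abs, abs_of_nonneg (hb _).1]
    exact (hb _).2

lemma ls_main {n : ℕ} {C₁ C₃ ε : ℝ} {h : (Fin n → ℝ) → ℝ} (hC1 : 1 ≤ C₁) (hC : 1 ≤ C₃)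
    (hh : ContDiff ℝ 3 h) (hb : ∀ x, 0 ≤ h x ∧ h x ≤ 1)
    (h1 : ∀ (x : Fin n → ℝ) (i : Fin n), |fderiv ℝ h x (Pi.single i 1)| ≤ C₁ * h x)
    (hε : 0 < ε) (hε1 : C₁ * ε ≤ 1 / 2) (Y : Fin n → ℝ)
    {L : Fin n → ℝ} {H : Fin n → Fin n → ℝ}
    (hT : ∀ (x : Fin n → ℝ) (M : ℝ),
      (∀ t ∈ Set.Icc (0:ℝ) 1, h (Y + t • x) ≤ M) →
      |h (Y + x) - (h Y + ∑ i, L i * x i + ∑ i, ∑ j, H i j * (x i * x j))|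
        ≤ C₃ * M * (∑ i, |x i|) ^ 3 / 2)
    {W : Fin n → Ω → ℝ} (hW : ∀ i, AEMeasurable (W i) P) (hW1 : ∀ i, Integrable (W i) P)
    (hW0 : ∀ i, ∫ ω, W i ω ∂P = 0) (hW3 : ∀ i, Integrable (fun ω => |W i ω| ^ 3) P)
    {r : Fin n → Fin n → ℝ} (hr : ∀ i j, ∫ ω, W i ω * W j ω ∂P = r i j) :
    |(∫ ω, h (fun i => Y i + W i ω) ∂P) - (h Y + ∑ i, ∑ j, H i j * r i j)| ≤
      C₃ / 2 * (Real.exp (1/2) * (ε^3 * h Y) + ∑ i, ∫ ω, lsT n ε (W i ω) ∂P) := by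
  have i1 : Integrable (fun ω => ∑ i, L i * W i ω) P :=
    integrable_finsetSum _ fun i _ => (hW1 i).const_mul _
  have i2 : ∀ i j, Integrable (fun ω => H i j * (W i ω * W j ω)) P := fun i j =>
    (ls_int_prod (hW i) (hW j) (hW3 i) (hW3 j)).const_mul _
  have i3 : Integrable (fun ω => ∑ i, ∑ j, H i j * (W i ω * W j ω)) P :=
    integrable_finsetSum _ fun i _ => integrable_finsetSum _ fun j _ => i2 i j
  have i0 : Integrable (fun ω => h Y + ∑ i, L i * W i ω) P := (integrable_const _).add i1
  have i4 : Integrable (fun ω => h Y + ∑ i, L i * W i ω + ∑ i, ∑ j, H i j * (W i ω * W j ω)) P :=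
    i0.add i3
  have e : h Y + ∑ i, ∑ j, H i j * r i j =
      ∫ ω, (h Y + ∑ i, L i * W i ω + ∑ i, ∑ j, H i j * (W i ω * W j ω)) ∂P := by
    rw [integral_add i0 i3, integral_add (integrable_const _) i1,
      integral_finsetSum _ (fun i _ => (hW1 i).const_mul _),
      integral_finsetSum _ (fun i _ => integrable_finsetSum _ fun j _ => i2 i j)]
    simp_rw [integral_finsetSum _ (fun j _ => i2 _ j), integral_const_mul, hW0, hr]
    simp
  have iT : Integrable (fun ω => ∑ i, lsT n ε (W i ω)) P :=
    integrable_finsetSum _ fun i _ => lsT_integrable hε (hW i) (hW3 i)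
  rw [e, ← integral_sub (ls_int_h hh hb Y hW) i4]
  have e2 : C₃ / 2 * (Real.exp (1/2) * (ε^3 * h Y) + ∑ i, ∫ ω, lsT n ε (W i ω) ∂P) =
      ∫ ω, C₃ / 2 * (Real.exp (1/2) * (ε^3 * h Y) + ∑ i, lsT n ε (W i ω)) ∂P := by
    rw [integral_const_mul, integral_add (integrable_const _) iT,
      integral_finsetSum _ (fun i _ => lsT_integrable hε (hW i) (hW3 i))]
    simp
  rw [e2, ← Real.norm_eq_abs]
  refine norm_integral_le_of_norm_le (((integrable_const _).add iT).const_mul _)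
    (ae_of_all _ fun ω => ?_)
  rw [Real.norm_eq_abs]
  have hnn : 0 ≤ ∑ i, lsT n ε (W i ω) := Finset.sum_nonneg fun i _ => lsT_nonneg n hε _
  have hex := Real.exp_pos (1/2)
  have hY := (hb Y).1
  by_cases hs : ∀ i, |W i ω| ≤ ε / n
  · have hsum := ls_sum_small hε hs
    have hs0 : 0 ≤ ∑ i, |W i ω| := Finset.sum_nonneg fun i _ => abs_nonneg _
    have := hT (fun i => W i ω) (Real.exp (1/2) * h Y) (fun t ht => by
      refine (ls_growth hh h1 Y _).trans (mul_le_mul_of_nonneg_right (Real.exp_le_exp.2 ?_) hY)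
      simp only [Pi.smul_apply, smul_eq_mul, abs_mul, ← Finset.mul_sum, abs_of_nonneg ht.1]
      have : t * ∑ i, |W i ω| ≤ ε := by nlinarith [ht.1, ht.2]
      nlinarith)
    refine this.trans ?_
    have h3 := pow_le_pow_left₀ hs0 hsum 3
    have hp : 0 ≤ C₃ * (Real.exp (1/2) * h Y) := by positivity
    nlinarith [mul_le_mul_of_nonneg_left h3 hp]
  · have := hT (fun i => W i ω) 1 (fun t _ => (hb _).2)
    refine this.trans ?_
    have h3 := ls_large hε hs
    have hp : 0 ≤ C₃ * (Real.exp (1/2) * (ε^3 * h Y)) := by positivity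
    nlinarith

lemma ls_compare {n : ℕ} {C₁ ε : ℝ} {h : (Fin n → ℝ) → ℝ} (hC1 : 1 ≤ C₁)
    (hh : ContDiff ℝ 3 h) (hb : ∀ x, 0 ≤ h x ∧ h x ≤ 1)
    (h1 : ∀ (x : Fin n → ℝ) (i : Fin n), |fderiv ℝ h x (Pi.single i 1)| ≤ C₁ * h x)
    (hε : 0 < ε) (hε1 : C₁ * ε ≤ 1 / 2) (Y : Fin n → ℝ)
    {W : Fin n → Ω → ℝ} (hW : ∀ i, AEMeasurable (W i) P)
    (hW3 : ∀ i, Integrable (fun ω => |W i ω| ^ 3) P) :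
    ε^3 * h Y ≤ ε^3 * Real.exp (1/2) * (∫ ω, h (fun i => Y i + W i ω) ∂P) +
      ∑ i, ∫ ω, lsT n ε (W i ω) ∂P := by
  have iT : Integrable (fun ω => ∑ i, lsT n ε (W i ω)) P :=
    integrable_finsetSum _ fun i _ => lsT_integrable hε (hW i) (hW3 i)
  have ih := (ls_int_h hh hb Y hW).const_mul (ε^3 * Real.exp (1/2))
  have e1 : ε^3 * h Y = ∫ _ω, ε^3 * h Y ∂P := by simp
  rw [e1, ← integral_finsetSum _ (fun i _ => lsT_integrable hε (hW i) (hW3 i)),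
    ← integral_const_mul, ← integral_add ih iT]
  refine integral_mono (integrable_const _) (ih.add iT) fun ω => ?_
  simp only
  have hnn : 0 ≤ ∑ i, lsT n ε (W i ω) := Finset.sum_nonneg fun i _ => lsT_nonneg n hε _
  have hex := Real.exp_pos (1/2)
  have hp := (hb (fun i => Y i + W i ω)).1
  by_cases hs : ∀ i, |W i ω| ≤ ε / n
  · have hsum := ls_sum_small hε hs
    have hg := ls_growth hh h1 (fun i => Y i + W i ω) (fun i => - W i ω)
    have e2 : (fun i => Y i + W i ω) + (fun i => - W i ω) = Y := by ext i; simp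
    rw [e2] at hg
    have h2 : h Y ≤ Real.exp (1/2) * h (fun i => Y i + W i ω) := by
      refine hg.trans (mul_le_mul_of_nonneg_right (Real.exp_le_exp.2 ?_) hp)
      simp only [abs_neg]
      nlinarith
    have := mul_le_mul_of_nonneg_left h2 (pow_pos hε 3).le
    linarith
  · push Not at hs
    obtain ⟨i, hi⟩ := hs
    have h2 : ε^3 ≤ lsT n ε (W i ω) := by
      simp only [lsT, hi, if_true]
      have : 0 ≤ (n:ℝ)^2 * |W i ω|^3 := by positivity
      linarith
    have h3 := Finset.single_le_sum (f := fun i => lsT n ε (W i ω))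
      (fun i _ => lsT_nonneg n hε _) (Finset.mem_univ i)
    have h4 : 0 ≤ ε^3 * Real.exp (1/2) * h (fun i => Y i + W i ω) := by positivity
    have h5 : ε^3 * h Y ≤ ε^3 := mul_le_of_le_one_right (by positivity) (hb Y).2
    linarith

end prob

lemma ls_gamma {D A H E : ℝ} (hA : 0 ≤ A) (hH : 0 ≤ H) (hE : 0 ≤ E) (h : |D| ≤ A * H + E) :
    ∃ γ, |γ| ≤ A ∧ |D - γ * H| ≤ E := by
  by_cases hd : |D| ≤ A * H
  · rcases hH.eq_or_lt with rfl | hH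
    · refine ⟨0, by simpa, ?_⟩
      simp at hd
      simpa [hd]
    · refine ⟨D / H, ?_, ?_⟩
      · rw [abs_div, abs_of_pos hH, div_le_iff₀ hH]; exact hd
      · rw [div_mul_cancel₀ _ hH.ne']; simpa
  · push Not at hd
    rcases le_total 0 D with h0 | h0
    · rw [abs_of_nonneg h0] at *
      refine ⟨A, by rw [abs_of_nonneg hA], ?_⟩
      rw [abs_of_nonneg (by linarith)]; linarith
    · rw [abs_of_nonpos h0] at *
      refine ⟨-A, by rw [abs_neg, abs_of_nonneg hA], ?_⟩
      rw [abs_of_nonpos (by linarith)]; linarith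

lemma ls_gauss_facts {Ω : Type} {mΩ : MeasurableSpace Ω} {P : Measure Ω} {U : Ω → ℝ} {v : NNReal}
    (h : P.map U = gaussianReal 0 v) :
    AEMeasurable U P ∧ Integrable U P ∧ ∫ ω, U ω ∂P = 0 ∧ Integrable (fun ω => |U ω| ^ 3) P ∧
      ∫ ω, U ω * U ω ∂P = v := by
  have hm : AEMeasurable U P := by
    by_contra hc
    rw [Measure.map_of_not_aemeasurable hc] at h
    exact (IsProbabilityMeasure.ne_zero (gaussianReal 0 v)) h.symm
  have h1 : Integrable (fun x : ℝ => x) (gaussianReal 0 v) :=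
    (memLp_id_gaussianReal (μ := 0) (v := v) 1).integrable (by norm_num)
  refine ⟨hm, ?_, ?_, ?_, ?_⟩
  · rw [← h] at h1
    exact h1.comp_aemeasurable hm
  · have := integral_map hm (f := fun x : ℝ => x) (by fun_prop)
    rw [← this, h, integral_id_gaussianReal]
  · have h3 := ls_int_abs3 v
    rw [← h] at h3
    exact h3.comp_aemeasurable hm
  · have := integral_map hm (f := fun x : ℝ => x * x) (by fun_prop)
    rw [← this, h]
    have hv := variance_fun_id_gaussianReal (μ := 0) (v := v)
    rw [variance_of_integral_eq_zero (by fun_prop) integral_id_gaussianReal] at hv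
    simpa [sq] using hv

lemma ls_sq_expand {Ω : Type} {mΩ : MeasurableSpace Ω} {P : Measure Ω} {U V : Ω → ℝ}
    (h1 : Integrable (fun ω => U ω * U ω) P) (h2 : Integrable (fun ω => V ω * U ω) P)
    (h3 : Integrable (fun ω => U ω * V ω) P) (h4 : Integrable (fun ω => V ω * V ω) P) :
    ∫ ω, (U ω + V ω) * (U ω + V ω) ∂P = ∫ ω, U ω * U ω ∂P + ∫ ω, V ω * U ω ∂P +
      (∫ ω, U ω * V ω ∂P + ∫ ω, V ω * V ω ∂P) := by
  have a : Integrable (fun ω => U ω * U ω + V ω * U ω) P := h1.add h2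
  have b : Integrable (fun ω => U ω * V ω + V ω * V ω) P := h3.add h4
  simp only [add_mul, mul_add]
  rw [integral_add a b, integral_add h1 h2, integral_add h3 h4]

theorem lindeberg_swap :
    ∃ K : ℝ, ∀ (n : ℕ) (C₁ C₃ : ℝ), 1 ≤ C₁ → 1 ≤ C₃ →
      ∀ h : (Fin n → ℝ) → ℝ,
        ContDiff ℝ 3 h →
        (∀ x, 0 ≤ h x ∧ h x ≤ 1) →
        (∀ (x : Fin n → ℝ) (i : Fin n), |fderiv ℝ h x (Pi.single i 1)| ≤ C₁ * h x) →
        (∀ (x : Fin n → ℝ) (i j k : Fin n),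
          |iteratedFDeriv ℝ 3 h x ![Pi.single i 1, Pi.single j 1, Pi.single k 1]| ≤ C₃ * h x) →
      ∀ ε : ℝ, 0 < ε → ε ≤ min (1 / (2 * C₁)) (1 / (2 * C₃ ^ ((1 : ℝ) / 3))) →
      ∀ Y : Fin n → ℝ,
      ∀ (Ω : Type) (mΩ : MeasurableSpace Ω) (μ : Measure Ω), IsProbabilityMeasure μ →
      ∀ X : Fin n → Ω → ℝ,
        (∀ i, Measurable (X i)) →
        (∀ i, Integrable (X i) μ) →
        (∀ i, ∫ ω, X i ω ∂μ = 0) →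
        (∀ i, Integrable (fun ω => |X i ω| ^ 3) μ) →
      ∀ (Ω' : Type) (mΩ' : MeasurableSpace Ω') (μ' : Measure Ω'), IsProbabilityMeasure μ' →
      ∀ Z : Fin n → Ω' → ℝ,
        IsCenteredGaussianVector μ' Z (fun i j => ∫ ω, X i ω * X j ω ∂μ) →
      ∃ γ : ℝ, |γ| ≤ 6 * C₃ * ε ^ 3 ∧
        |(∫ ω, h (fun i => Y i + X i ω) ∂μ) - (1 + γ) * ∫ ω, h (fun i => Y i + Z i ω) ∂μ'|
          ≤ K * C₃ *
            ((∑ i, ∫ ω, (if ε / n < |X i ω| then ε ^ 3 + (n : ℝ) ^ 2 * |X i ω| ^ 3 else 0) ∂μ) +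
             ∑ i, (ε ^ 3 + (n : ℝ) ^ 2 * (∫ ω, X i ω * X i ω ∂μ) ^ ((3 : ℝ) / 2)) *
               (if (∫ ω, X i ω * X i ω ∂μ) = 0 then 0
                else Real.exp (-(ε ^ 2 / (2 * (n : ℝ) ^ 2 * ∫ ω, X i ω * X i ω ∂μ))))) := by
  classical
  refine ⟨3 * (10 + 8 * lsM), ?_⟩
  intro n C₁ C₃ hC1 hC3 h hh hb h1 h3 ε hε hεm Y Ω mΩ μ hμ X hXm hX1 hX0 hX3 Ω' mΩ' μ' hμ' Z hZ
  have hε1 : C₁ * ε ≤ 1 / 2 := by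
    have := hεm.trans (min_le_left _ _)
    rw [le_div_iff₀ (by positivity)] at this
    linarith
  have iX : ∀ i j, Integrable (fun ω => X i ω * X j ω) μ := fun i j =>
    ls_int_prod (hXm i).aemeasurable (hXm j).aemeasurable (hX3 i) (hX3 j)
  set R : Fin n → Fin n → ℝ := fun i j => ∫ ω, X i ω * X j ω ∂μ with hR
  have hRs : ∀ i j, R i j = R j i := fun i j => by simp only [hR, mul_comm]
  have hRnn : ∀ i, 0 ≤ R i i := fun i => integral_nonneg fun ω => mul_self_nonneg _
  have hZ1 : ∀ i, μ'.map (Z i) = gaussianReal 0 (R i i).toNNReal := by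
    intro i
    have := hZ (Pi.single i 1)
    simpa [Pi.single_apply] using this
  have hZ2 : ∀ i j, μ'.map (fun ω => Z i ω + Z j ω) =
      gaussianReal 0 (R i i + R j i + (R i j + R j j)).toNNReal := by
    intro i j
    have := hZ (Pi.single i 1 + Pi.single j 1)
    simpa [Pi.single_apply, add_mul, mul_add, Finset.sum_add_distrib, add_assoc] using this
  have hZf := fun i => ls_gauss_facts (hZ1 i)
  have iZ : ∀ i j, Integrable (fun ω => Z i ω * Z j ω) μ' := fun i j =>
    ls_int_prod (hZf i).1 (hZf j).1 (hZf i).2.2.2.1 (hZf j).2.2.2.1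
  have hZr : ∀ i j, ∫ ω, Z i ω * Z j ω ∂μ' = R i j := by
    intro i j
    have e1 := (ls_gauss_facts (hZ2 i j)).2.2.2.2
    have hnn : 0 ≤ R i i + R j i + (R i j + R j j) := by
      have e : R i i + R j i + (R i j + R j j) = ∫ ω, (X i ω + X j ω) * (X i ω + X j ω) ∂μ := by
        rw [ls_sq_expand (iX i i) (iX j i) (iX i j) (iX j j)]
      rw [e]
      exact integral_nonneg fun ω => mul_self_nonneg _
    rw [Real.coe_toNNReal _ hnn] at e1
    rw [ls_sq_expand (iZ i i) (iZ j i) (iZ i j) (iZ j j)] at e1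
    have e2 := (hZf i).2.2.2.2
    have e3 := (hZf j).2.2.2.2
    rw [Real.coe_toNNReal _ (hRnn _)] at e2 e3
    have e4 : ∫ ω, Z j ω * Z i ω ∂μ' = ∫ ω, Z i ω * Z j ω ∂μ' := by simp only [mul_comm]
    have e5 := hRs i j
    linarith
  obtain ⟨L, H, hT⟩ := ls_taylor hC3 hh h3 Y
  have mX := ls_main hC1 hC3 hh hb h1 hε hε1 Y hT (fun i => (hXm i).aemeasurable) hX1 hX0 hX3
    (r := R) (fun i j => rfl)
  have mZ := ls_main hC1 hC3 hh hb h1 hε hε1 Y hT (fun i => (hZf i).1) (fun i => (hZf i).2.1)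
    (fun i => (hZf i).2.2.1) (fun i => (hZf i).2.2.2.1) (r := R) hZr
  have cZ := ls_compare hC1 hh hb h1 hε hε1 Y (fun i => (hZf i).1) (fun i => (hZf i).2.2.2.1)
  have gZ : ∑ i, ∫ ω, lsT n ε (Z i ω) ∂μ' ≤ (10 + 8 * lsM) *
      ∑ i, (ε ^ 3 + (n : ℝ) ^ 2 * (R i i) ^ ((3 : ℝ) / 2)) *
               (if R i i = 0 then 0
                else Real.exp (-(ε ^ 2 / (2 * (n : ℝ) ^ 2 * R i i)))) := by
    rw [Finset.mul_sum]
    refine Finset.sum_le_sum fun i _ => ?_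
    have := integral_map (hZf i).1 (f := lsT n ε) (lsT_measurable n ε).aestronglyMeasurable
    rw [← this, hZ1 i]
    exact ls_gauss i.pos hε (hRnn i)
  change ∃ γ : ℝ, |γ| ≤ 6 * C₃ * ε ^ 3 ∧
        |(∫ ω, h (fun i => Y i + X i ω) ∂μ) - (1 + γ) * ∫ ω, h (fun i => Y i + Z i ω) ∂μ'|
          ≤ 3 * (10 + 8 * lsM) * C₃ * ((∑ i, ∫ ω, lsT n ε (X i ω) ∂μ) +
            ∑ i, (ε ^ 3 + (n : ℝ) ^ 2 * (R i i) ^ ((3 : ℝ) / 2)) *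
               (if R i i = 0 then 0
                else Real.exp (-(ε ^ 2 / (2 * (n : ℝ) ^ 2 * R i i)))))
  set S := ∑ i, (ε ^ 3 + (n : ℝ) ^ 2 * (R i i) ^ ((3 : ℝ) / 2)) *
               (if R i i = 0 then 0
                else Real.exp (-(ε ^ 2 / (2 * (n : ℝ) ^ 2 * R i i))))
  have hS : 0 ≤ S := Finset.sum_nonneg fun i _ => by
    have := Real.rpow_nonneg (hRnn i) ((3:ℝ)/2)
    split_ifs <;> positivity
  set TX := ∑ i, ∫ ω, lsT n ε (X i ω) ∂μ
  have hTX : 0 ≤ TX := Finset.sum_nonneg fun i _ => integral_nonneg fun ω => lsT_nonneg n hε _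
  set TZ := ∑ i, ∫ ω, lsT n ε (Z i ω) ∂μ'
  have hTZ : 0 ≤ TZ := Finset.sum_nonneg fun i _ => integral_nonneg fun ω => lsT_nonneg n hε _
  set EX := ∫ ω, h (fun i => Y i + X i ω) ∂μ
  set EZ := ∫ ω, h (fun i => Y i + Z i ω) ∂μ'
  have hEZ : 0 ≤ EZ := integral_nonneg fun ω => (hb _).1
  have hM := lsM_nonneg
  have hx0 := Real.exp_pos (1/2)
  have hx1 : Real.exp (1/2) * Real.exp (1/2) ≤ 3 := by
    rw [← Real.exp_add]
    norm_num
    linarith [Real.exp_one_lt_d9]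
  have hx2 : Real.exp (1/2) ≤ 2 := by nlinarith
  have hC0 : 0 < C₃ := by linarith
  have key : |EX - EZ| ≤ 6 * C₃ * ε^3 * EZ + 3 * (10 + 8 * lsM) * C₃ * (TX + S) := by
    have t1 : |EX - EZ| ≤ C₃ / 2 * (Real.exp (1/2) * (ε^3 * h Y) + TX) +
        C₃ / 2 * (Real.exp (1/2) * (ε^3 * h Y) + TZ) := by
      rw [abs_le] at mX mZ ⊢
      constructor <;> linarith
    have t2 : Real.exp (1/2) * (ε^3 * h Y) ≤ 3 * (ε^3 * EZ) + 2 * TZ := by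
      have a1 := mul_le_mul_of_nonneg_left cZ hx0.le
      have a2 : 0 ≤ ε^3 * EZ := by positivity
      have a3 := mul_le_mul_of_nonneg_right hx1 a2
      have a4 := mul_le_mul_of_nonneg_right hx2 hTZ
      nlinarith
    have t3 : |EX - EZ| ≤ C₃ * (6 * (ε^3 * EZ) + 3 * (TX + TZ)) := by
      refine t1.trans ?_
      rw [← mul_add, div_mul_eq_mul_div, mul_div_assoc]
      refine mul_le_mul_of_nonneg_left ?_ hC0.le
      have a2 : 0 ≤ ε^3 * EZ := by positivity
      linarith
    have t4 : TX + TZ ≤ (10 + 8 * lsM) * (TX + S) := by nlinarith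
    refine t3.trans ?_
    have := mul_le_mul_of_nonneg_left t4 hC0.le
    nlinarith
  obtain ⟨γ, hγ, hγ2⟩ := ls_gamma (by positivity) hEZ (by positivity) key
  refine ⟨γ, hγ, ?_⟩
  rw [show EX - (1 + γ) * EZ = EX - EZ - γ * EZ by ring]
  exact hγ2
end

section
/- Let n ≥ 2 and 1 ≤ k ≤ n/2, and let A = A(ξ) be the n×n real matrix which equals the identity except that A_{2j−1,2j} = A_{2j,2j−1} = ξ for 1 ≤ j ≤ k. Suppose |ξ| ≤ 1/2, and let E be an n×n real matrix all of whose entries are bounded in absolute value by ε, where 0 ≤ ε ≤ 1/(4n). Then there is an absolute constant K such that: (i) det(A+E) = det(A) · (1 + η) for some real η with |η| ≤ K ε n (and det A = (1−ξ²)^k); (ii) A+E is invertible, and (A+E)^{−1} = A^{−1} + F where every entry of F is bounded in absolute value by 8ε. -/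
/-- The `n × n` matrix which equals the identity except that the `2×2` diagonal blocks
indexed by the pairs `{2j-1, 2j}` (1-based), for `1 ≤ j ≤ k`, are `[[1, ξ], [ξ, 1]]`. -/
def pairMatrix (n k : ℕ) (ξ : ℝ) : Matrix (Fin n) (Fin n) ℝ :=
  Matrix.of fun i j =>
    if i = j then 1
    else if i.val / 2 = j.val / 2 ∧ i.val / 2 < k then ξ else 0

open Matrix in
theorem aux_sup {m : ℕ} (N : Matrix (Fin m) (Fin m) ℝ) (hN : ∀ i, ∑ j, |N i j| ≤ 1 / 2)
    (x v : Fin m → ℝ) (c : ℝ) (h : (1 + N) *ᵥ x = v) (hv : ∀ i, |v i| ≤ c) :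
    ∀ i, |x i| ≤ 2 * c := by
  intro i
  obtain ⟨p, -, hp⟩ := Finset.exists_max_image Finset.univ (fun i => |x i|) ⟨i, Finset.mem_univ i⟩
  have h1 : x p + ∑ j, N p j * x j = v p := by
    rw [← h, add_mulVec, one_mulVec]
    rfl
  have h2 : |∑ j, N p j * x j| ≤ (1 / 2) * |x p| := by
    calc |∑ j, N p j * x j| ≤ ∑ j, |N p j * x j| := Finset.abs_sum_le_sum_abs _ _
      _ ≤ ∑ j, |N p j| * |x p| := by
        refine Finset.sum_le_sum fun j _ => ?_
        rw [abs_mul]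
        exact mul_le_mul_of_nonneg_left (hp j (Finset.mem_univ j)) (abs_nonneg _)
      _ = (∑ j, |N p j|) * |x p| := by rw [Finset.sum_mul]
      _ ≤ _ := mul_le_mul_of_nonneg_right (hN p) (abs_nonneg _)
  have h3 : |x p| ≤ |v p| + |∑ j, N p j * x j| := by
    have : x p = v p - ∑ j, N p j * x j := by linarith
    calc |x p| = |v p - ∑ j, N p j * x j| := by rw [← this]
      _ ≤ _ := abs_sub _ _
  have := hp i (Finset.mem_univ i)
  have := hv p
  linarith

open Matrix in
theorem aux_unit {m : ℕ} (N : Matrix (Fin m) (Fin m) ℝ) (hN : ∀ i, ∑ j, |N i j| ≤ 1 / 2) :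
    IsUnit (1 + N).det := by
  rw [isUnit_iff_ne_zero]
  intro h
  obtain ⟨x, hx, hx0⟩ := Matrix.exists_mulVec_eq_zero_iff.mpr h
  apply hx
  ext i
  have := aux_sup N hN x 0 0 hx0 (by simp) i
  simpa using this

theorem aux_rows {m : ℕ} (B : Matrix (Fin m) (Fin m) ℝ) (d : ℝ) (hB : ∀ i j, |B i j| ≤ d)
    (hd : m * d ≤ 1 / 2) : ∀ i, ∑ j, |B i j| ≤ 1 / 2 := by
  intro i
  calc ∑ j, |B i j| ≤ ∑ _j : Fin m, d := Finset.sum_le_sum fun j _ => hB i j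
    _ = m * d := by simp
    _ ≤ _ := hd

open Matrix in
theorem aux_det (d : ℝ) (hd0 : 0 ≤ d) : ∀ (m : ℕ) (B : Matrix (Fin m) (Fin m) ℝ),
    (∀ i j, |B i j| ≤ d) → m * d ≤ 1 / 2 →
    (1 - 2 * d) ^ m ≤ (1 + B).det ∧ (1 + B).det ≤ (1 + 2 * d) ^ m := by
  intro m
  induction m with
  | zero => intro B _ _; simp
  | succ m ih =>
    intro B hB hm
    push_cast at hm
    have hm' : m * d ≤ 1 / 2 := by linarith
    have hmd : 0 ≤ m * d := by positivity
    let M := (1 + B).submatrix (finSumFinEquiv (m := m) (n := 1)) finSumFinEquiv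
    have hdet : (1 + B).det = M.det := (det_submatrix_equiv_self _ _).symm
    let B' : Matrix (Fin m) (Fin m) ℝ := Matrix.of fun i j => B (Fin.castAdd 1 i) (Fin.castAdd 1 j)
    have hB' : ∀ i j, |B' i j| ≤ d := fun i j => hB _ _
    have h11 : M.toBlocks₁₁ = 1 + B' := by
      ext i j
      simp [M, toBlocks₁₁, B', Matrix.one_apply]
    obtain ⟨l, u⟩ := ih B' hB' hm'
    have hU := aux_unit B' (aux_rows B' d hB' hm')
    haveI : Invertible (1 + B') := Matrix.invertibleOfIsUnitDet _ hU
    have hdet2 : M.det = (1 + B').det * (M.toBlocks₂₂ - M.toBlocks₂₁ * ⅟(1 + B') * M.toBlocks₁₂).det := by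
      conv_lhs => rw [← fromBlocks_toBlocks M, h11]
      exact det_fromBlocks₁₁ _ _ _ _
    have hx : ∀ i, |(⅟(1 + B') * M.toBlocks₁₂) i 0| ≤ 2 * d := by
      refine aux_sup B' (aux_rows B' d hB' hm') (fun i => (⅟(1 + B') * M.toBlocks₁₂) i 0)
        (fun i => M.toBlocks₁₂ i 0) d ?_ ?_
      · ext i
        have : ((1 + B') * (⅟(1 + B') * M.toBlocks₁₂) : Matrix (Fin m) (Fin 1) ℝ) i 0 = M.toBlocks₁₂ i 0 := by
          rw [← Matrix.mul_assoc, mul_invOf_self, Matrix.one_mul]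
        exact this
      · intro i
        have : M.toBlocks₁₂ i 0 = B (Fin.castAdd 1 i) (Fin.natAdd m 0) := by
          have : Fin.castAdd 1 i ≠ Fin.natAdd m 0 := by
            intro h; have := congrArg Fin.val h; simp at this; omega
          simp only [M, toBlocks₁₂, of_apply, submatrix_apply, Matrix.add_apply, finSumFinEquiv_apply_left,
            finSumFinEquiv_apply_right, one_apply_ne this, zero_add]
        rw [this]; exact hB _ _
    have h21 : ∀ i, |M.toBlocks₂₁ 0 i| ≤ d := by
      intro i
      have : M.toBlocks₂₁ 0 i = B (Fin.natAdd m 0) (Fin.castAdd 1 i) := by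
        have : Fin.natAdd m 0 ≠ Fin.castAdd 1 i := by
          intro h; have := congrArg Fin.val h; simp at this; omega
        simp only [M, toBlocks₂₁, of_apply, submatrix_apply, Matrix.add_apply, finSumFinEquiv_apply_left,
          finSumFinEquiv_apply_right, one_apply_ne this, zero_add]
      rw [this]; exact hB _ _
    have h22 : M.toBlocks₂₂ 0 0 = 1 + B (Fin.natAdd m 0) (Fin.natAdd m 0) := by
      simp only [M, toBlocks₂₂, of_apply, submatrix_apply, Matrix.add_apply,
          finSumFinEquiv_apply_right, one_apply_eq]
    have hs : |(M.toBlocks₂₁ * (⅟(1 + B') * M.toBlocks₁₂)) 0 0| ≤ d := by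
      rw [Matrix.mul_apply]
      calc _ ≤ ∑ j, |M.toBlocks₂₁ 0 j * (⅟(1 + B') * M.toBlocks₁₂) j 0| :=
            Finset.abs_sum_le_sum_abs _ _
        _ ≤ ∑ _j : Fin m, d * (2 * d) := by
          refine Finset.sum_le_sum fun j _ => ?_
          rw [abs_mul]
          exact mul_le_mul (h21 j) (hx j) (abs_nonneg _) hd0
        _ = 2 * (m * d) * d := by simp; ring
        _ ≤ 1 * d := mul_le_mul_of_nonneg_right (by linarith) hd0
        _ = d := one_mul d
    have hb := hB (Fin.natAdd m 0) (Fin.natAdd m 0)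
    rw [abs_le] at hs hb
    rw [hdet, hdet2, det_fin_one, Matrix.mul_assoc, Matrix.sub_apply, h22]
    have hq : 0 ≤ 1 - 2 * d := by linarith
    rw [pow_succ, pow_succ]
    constructor
    · exact mul_le_mul l (by linarith) hq ((pow_nonneg hq m).trans l)
    · exact mul_le_mul u (by linarith) (by linarith) (by positivity)

theorem aux_pair_rows (n k : ℕ) (ξ : ℝ) (hξ : |ξ| ≤ 1 / 2) :
    ∀ i, ∑ j, |(pairMatrix n k ξ - 1) i j| ≤ 1 / 2 := by
  intro i
  have h : ∀ j, |(pairMatrix n k ξ - 1) i j| ≤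
      if (i ≠ j ∧ i.val / 2 = j.val / 2) then |ξ| else 0 := by
    intro j
    by_cases hij : i = j
    · subst hij; simp [pairMatrix]
    · simp only [pairMatrix, Matrix.sub_apply, Matrix.of_apply, Matrix.one_apply_ne hij, if_neg hij]
      by_cases h1 : i.val / 2 = j.val / 2
      · have hc : (i ≠ j ∧ i.val / 2 = j.val / 2) := ⟨hij, h1⟩
        simp only [if_pos hc]
        by_cases h2 : i.val / 2 < k
        · rw [if_pos ⟨h1, h2⟩, sub_zero]
        · rw [if_neg (fun h => h2 h.2)]; simp
      · simp [h1]
  refine (Finset.sum_le_sum fun j _ => h j).trans ?_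
  rw [← Finset.sum_filter, Finset.sum_const, nsmul_eq_mul]
  have hc : (Finset.univ.filter fun j : Fin n => i ≠ j ∧ i.val / 2 = j.val / 2).card ≤ 1 := by
    rw [Finset.card_le_one]
    intro a ha b hb
    simp only [Finset.mem_filter, Finset.mem_univ, true_and, ne_eq, Fin.ext_iff] at ha hb
    ext
    omega
  have hc' : ((Finset.univ.filter fun j : Fin n => i ≠ j ∧ i.val / 2 = j.val / 2).card : ℝ) ≤ 1 := by
    exact_mod_cast hc
  nlinarith [abs_nonneg ξ]

open Matrix in
theorem aux_pair_det (ξ : ℝ) : ∀ (k n : ℕ), 2 * k ≤ n →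
    (pairMatrix n k ξ).det = (1 - ξ ^ 2) ^ k := by
  intro k
  induction k with
  | zero =>
    intro n _
    have : pairMatrix n 0 ξ = 1 := by
      ext i j; simp [pairMatrix, Matrix.one_apply]
    simp [this]
  | succ k ih =>
    intro n hn
    obtain ⟨m, rfl⟩ : ∃ m, n = 2 + m := ⟨n - 2, by omega⟩
    rw [← det_submatrix_equiv_self (finSumFinEquiv (m := 2) (n := m))]
    have : (pairMatrix (2 + m) (k + 1) ξ).submatrix (finSumFinEquiv (m := 2) (n := m)) finSumFinEquiv
        = fromBlocks !![1, ξ; ξ, 1] 0 0 (pairMatrix m k ξ) := by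
      ext i j
      rcases i with i | i <;> rcases j with j | j
      · fin_cases i <;> fin_cases j <;> simp [pairMatrix, Fin.ext_iff]
      · have h1 : i.val / 2 ≠ (2 + j.val) / 2 := by omega
        have h2 : i.val ≠ 2 + j.val := by omega
        simp [pairMatrix, Fin.ext_iff, h2]
        omega
      · have h1 : (2 + i.val) / 2 ≠ j.val / 2 := by omega
        have h2 : 2 + i.val ≠ j.val := by omega
        simp [pairMatrix, Fin.ext_iff, h2]
        omega
      · have h1 : ((2 + i.val) / 2 = (2 + j.val) / 2 ∧ (2 + i.val) / 2 < k + 1) ↔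
          (i.val / 2 = j.val / 2 ∧ i.val / 2 < k) := by omega
        simp [pairMatrix, Fin.ext_iff, h1]
    rw [this, det_fromBlocks_zero₂₁, ih m (by omega), det_fin_two_of, pow_succ]
    ring

open Matrix in
theorem aux_sup_mat {n : ℕ} (N X V : Matrix (Fin n) (Fin n) ℝ) (hN : ∀ i, ∑ j, |N i j| ≤ 1 / 2)
    (c : ℝ) (h : (1 + N) * X = V) (hv : ∀ i j, |V i j| ≤ c) : ∀ i j, |X i j| ≤ 2 * c := by
  intro i j
  refine aux_sup N hN (fun i => X i j) (fun i => V i j) c ?_ (fun i => hv i j) i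
  rw [← h]
  rfl

theorem aux_pair_symm (n k : ℕ) (ξ : ℝ) : (pairMatrix n k ξ).transpose = pairMatrix n k ξ := by
  ext i j
  simp only [pairMatrix, Matrix.transpose_apply, Matrix.of_apply]
  by_cases h : i = j
  · simp [h]
  · rw [if_neg h, if_neg (Ne.symm h)]
    by_cases h1 : i.val / 2 = j.val / 2
    · simp [h1]
    · simp [h1, Ne.symm h1]

theorem covariance_matrix_perturbation :
    ∃ K : ℝ, ∀ (n k : ℕ), 2 ≤ n → 1 ≤ k → 2 * k ≤ n →
      ∀ ξ : ℝ, |ξ| ≤ 1 / 2 →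
      ∀ ε : ℝ, 0 ≤ ε → ε ≤ 1 / (4 * n) →
      ∀ E : Matrix (Fin n) (Fin n) ℝ, (∀ i j, |E i j| ≤ ε) →
        (pairMatrix n k ξ).det = (1 - ξ ^ 2) ^ k ∧
        (∃ η : ℝ, |η| ≤ K * ε * n ∧
          (pairMatrix n k ξ + E).det = (pairMatrix n k ξ).det * (1 + η)) ∧
        IsUnit (pairMatrix n k ξ + E).det ∧
        (∃ F : Matrix (Fin n) (Fin n) ℝ,
          (pairMatrix n k ξ + E)⁻¹ = (pairMatrix n k ξ)⁻¹ + F ∧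
          ∀ i j, |F i j| ≤ 8 * ε) := by
  refine ⟨8, ?_⟩
  intro n k hn hk hkn ξ hξ ε hε0 hε E hE
  have hn0 : (0 : ℝ) < n := by exact_mod_cast (by omega : 0 < n)
  have hnε : n * (2 * ε) ≤ 1 / 2 := by
    rw [le_div_iff₀ (by positivity)] at hε
    linarith
  have hrA := aux_pair_rows n k ξ hξ
  have hdA := aux_pair_det ξ k n hkn
  have hsA := aux_pair_symm n k ξ
  generalize pairMatrix n k ξ = A at *
  have hA1 : 1 + (A - 1) = A := by abel
  have hUA : IsUnit A.det := by
    have := aux_unit _ hrA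
    rwa [hA1] at this
  have hB : ∀ i j, |(A⁻¹ * E) i j| ≤ 2 * ε := by
    refine aux_sup_mat (A - 1) _ E hrA ε ?_ hE
    rw [hA1, Matrix.mul_nonsing_inv_cancel_left _ _ hUA]
  have hG : ∀ i j, |(E * A⁻¹) i j| ≤ 2 * ε := by
    have : ∀ i j, |(E * A⁻¹).transpose i j| ≤ 2 * ε := by
      refine aux_sup_mat (A - 1) _ E.transpose hrA ε ?_ (fun i j => hE j i)
      rw [hA1]
      conv_lhs => rw [← hsA]
      rw [← Matrix.transpose_mul, hsA, Matrix.nonsing_inv_mul_cancel_right _ _ hUA]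
    exact fun i j => this j i
  have hrB := aux_rows _ _ hB hnε
  have hfac : A + E = A * (1 + A⁻¹ * E) := by
    rw [Matrix.mul_add, Matrix.mul_one, Matrix.mul_nonsing_inv_cancel_left _ _ hUA]
  have hdet : (A + E).det = A.det * (1 + A⁻¹ * E).det := by rw [hfac, Matrix.det_mul]
  have hU : IsUnit (A + E).det := by
    rw [hdet]; exact hUA.mul (aux_unit _ hrB)
  refine ⟨hdA, ⟨(1 + A⁻¹ * E).det - 1, ?_, by rw [hdet]; ring⟩, hU, (A + E)⁻¹ - A⁻¹, by abel, ?_⟩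
  · obtain ⟨l, u⟩ := aux_det (2 * ε) (by linarith) n _ hB hnε
    have hn2 : (2 : ℝ) ≤ n := by exact_mod_cast hn
    have hl : 1 + (n : ℝ) * (-(2 * (2 * ε))) ≤ (1 + (-(2 * (2 * ε)))) ^ n :=
      one_add_mul_le_pow (by nlinarith) n
    have hu : (1 + 2 * (2 * ε)) ^ n ≤ Real.exp (n * (2 * (2 * ε))) := by
      rw [Real.exp_nat_mul]
      refine pow_le_pow_left₀ (by positivity) ?_ n
      linarith [Real.add_one_le_exp (2 * (2 * ε))]
    have hnn : 0 ≤ n * (2 * (2 * ε)) := by positivity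
    have he := Real.abs_exp_sub_one_le (x := n * (2 * (2 * ε))) (by rw [abs_of_nonneg hnn]; linarith)
    rw [abs_of_nonneg hnn] at he
    have he' := (abs_le.mp he).2
    rw [← sub_eq_add_neg] at hl
    rw [abs_le]
    constructor <;> linarith
  · have hF : (1 + A⁻¹ * E) * ((A + E)⁻¹ - A⁻¹) = A⁻¹ * (-(E * A⁻¹)) := by
      have h1 : 1 + A⁻¹ * E = A⁻¹ * (A + E) := by
        rw [Matrix.mul_add, Matrix.nonsing_inv_mul _ hUA]
      rw [h1, Matrix.mul_assoc, Matrix.mul_sub, Matrix.mul_nonsing_inv _ hU, Matrix.add_mul,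
        Matrix.mul_nonsing_inv _ hUA]
      congr 1
      abel
    have hV : ∀ i j, |(A⁻¹ * (-(E * A⁻¹))) i j| ≤ 2 * (2 * ε) := by
      refine aux_sup_mat (A - 1) _ (-(E * A⁻¹)) hrA (2 * ε) ?_ ?_
      · rw [hA1, Matrix.mul_nonsing_inv_cancel_left _ _ hUA]
      · intro i j
        rw [Matrix.neg_apply, abs_neg]
        exact hG i j
    intro i j
    have := aux_sup_mat _ _ _ hrB _ hF hV i j
    linarith
end

section
/- Let n ≥ 2, 1 ≤ k ≤ n/2, and Q ≥ 10, with n Q ≥ 3. Let A = A(ξ) be the n×n real matrix which equals the identity except that A_{2j−1,2j} = A_{2j,2j−1} = ξ for 1 ≤ j ≤ k, where |ξ| ≤ 1/Q. Let E be a symmetric n×n real matrix all of whose entries are bounded in absolute value by ε, where ε ≥ 0 and ε n ≤ 1/Q², and suppose C := A + E is a valid covariance matrix (positive semidefinite). Let Z = (Z₁,…,Zₙ) be a multivariate normal random vector with mean zero and covariance matrix C. Then there is an absolute constant K such that ℙ( ∑_{i=2k+1}^{n} Z_i² > 10 n log(nQ) ) ≤ exp(−3 n log(nQ) + K n) and ℙ(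 ∑_{i=1}^{2k} Z_i² > 10 k log(nQ) ) ≤ exp(−3 k log(nQ) + K k). -/
open MeasureTheory ProbabilityTheory

/-- Tonelli for product functions on a finite product. -/
lemma aux_pi_prod {n : ℕ} (ν : Measure ℝ) [IsProbabilityMeasure ν] (f : Fin n → ℝ → ENNReal)
    (hf : ∀ i, Measurable (f i)) :
    ∫⁻ g, ∏ i, f i (g i) ∂(Measure.pi fun _ : Fin n => ν) = ∏ i, ∫⁻ x, f i x ∂ν := by
  have h := iIndepFun_pi (μ := fun _ : Fin n => ν) (X := f) (fun i => (hf i).aemeasurable)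
  have h2 := lintegral_prod_eq_prod_lintegral_of_indepFun Finset.univ
    (fun i (g : Fin n → ℝ) => f i (g i)) h (fun i => (hf i).comp (measurable_pi_apply i))
  rw [h2]
  refine Finset.prod_congr rfl fun i _ => ?_
  exact (measurePreserving_eval (fun _ : Fin n => ν) i).lintegral_comp (hf i)

/-- Laplace transform of a centered Gaussian. -/
lemma aux_mgf {Ω : Type*} [MeasurableSpace Ω] {μ : Measure Ω} {X : Ω → ℝ} {v : NNReal}
    (hX : μ.map X = gaussianReal 0 v) :
    ∫⁻ ω, ENNReal.ofReal (Real.exp (X ω)) ∂μ = ENNReal.ofReal (Real.exp (v / 2)) := by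
  have hm : AEMeasurable X μ := aemeasurable_of_map_neZero (by rw [hX]; infer_instance)
  have h1 : Integrable (fun x : ℝ => Real.exp x) (gaussianReal 0 v) := by
    simpa using integrable_exp_mul_gaussianReal (μ := 0) (v := v) 1
  have h2 : Integrable (fun ω => Real.exp (X ω)) μ := by
    rw [← hX] at h1
    exact h1.comp_aemeasurable hm
  rw [← ofReal_integral_eq_lintegral_ofReal h2 (Filter.Eventually.of_forall fun _ => (Real.exp_pos _).le)]
  have := mgf_gaussianReal hX 1
  simp [mgf] at this
  rw [this]

lemma aux_sq : ∫⁻ x, ENNReal.ofReal (Real.exp (x ^ 2 / 3)) ∂(gaussianReal 0 1)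
    ≤ ENNReal.ofReal (Real.exp 1) := by
  rw [gaussianReal_of_var_ne_zero _ one_ne_zero,
    lintegral_withDensity_eq_lintegral_mul _ (measurable_gaussianPDF 0 1) (by fun_prop)]
  have : ∀ x : ℝ, (gaussianPDF 0 1 * fun x => ENNReal.ofReal (Real.exp (x ^ 2 / 3))) x
      = ENNReal.ofReal ((√(2 * Real.pi))⁻¹ * Real.exp (-(1/6) * x ^ 2)) := by
    intro x
    simp only [Pi.mul_apply, gaussianPDF, gaussianPDFReal]
    rw [← ENNReal.ofReal_mul (by positivity), mul_assoc, ← Real.exp_add]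
    congr 3
    · simp
    · simp; ring
  simp_rw [this]
  rw [← ofReal_integral_eq_lintegral_ofReal
    ((integrable_exp_neg_mul_sq (by norm_num)).const_mul _)
    (Filter.Eventually.of_forall fun _ => by positivity), integral_const_mul, integral_gaussian]
  apply ENNReal.ofReal_le_ofReal
  rw [inv_mul_le_iff₀ (by positivity)]
  have h1 : √(Real.pi / (1/6)) = √(2 * Real.pi) * √3 := by
    rw [← Real.sqrt_mul (by positivity)]; congr 1; ring
  rw [h1]
  gcongr
  rw [Real.sqrt_le_left (Real.exp_pos _).le]
  have := Real.add_one_le_exp (1:ℝ)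
  nlinarith

lemma aux_quad {n : ℕ} (C : Fin n → Fin n → ℝ) (hs : ∀ i j, C i j = C j i) (L : ℝ)
    (hr : ∀ i, ∑ j, |C i j| ≤ L) (t : Fin n → ℝ) :
    ∑ i, ∑ j, t i * t j * C i j ≤ L * ∑ i, t i ^ 2 := by
  have h1 : ∀ i j, t i * t j * C i j ≤ t i ^ 2 * |C i j| / 2 + t j ^ 2 * |C j i| / 2 := by
    intro i j
    rw [hs j i]
    have ha : t i * t j * C i j ≤ |t i * t j| * |C i j| := by
      rw [← abs_mul]; exact le_abs_self _
    have hb : |t i * t j| ≤ (t i ^ 2 + t j ^ 2) / 2 := by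
      rw [abs_le]; constructor <;> nlinarith [sq_nonneg (t i + t j), sq_nonneg (t i - t j)]
    nlinarith [mul_le_mul_of_nonneg_right hb (abs_nonneg (C i j))]
  calc _ ≤ ∑ i, ∑ j, (t i ^ 2 * |C i j| / 2 + t j ^ 2 * |C j i| / 2) :=
        Finset.sum_le_sum fun i _ => Finset.sum_le_sum fun j _ => h1 i j
    _ = ∑ i, t i ^ 2 * ∑ j, |C i j| := by
        simp_rw [Finset.sum_add_distrib]
        rw [Finset.sum_comm (f := fun i j => t j ^ 2 * |C j i| / 2), ← Finset.sum_add_distrib]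
        refine Finset.sum_congr rfl fun i _ => ?_
        rw [← Finset.sum_add_distrib, Finset.mul_sum]
        refine Finset.sum_congr rfl fun j _ => ?_
        ring
    _ ≤ ∑ i, t i ^ 2 * L := Finset.sum_le_sum fun i _ =>
        mul_le_mul_of_nonneg_left (hr i) (sq_nonneg _)
    _ = _ := by rw [← Finset.sum_mul, mul_comm]

lemma aux_row {n k : ℕ} {Q ξ ε : ℝ} (hQ : 10 ≤ Q) (hξ : |ξ| ≤ 1 / Q)
    (hεn : ε * n ≤ 1 / Q ^ 2) (E : Matrix (Fin n) (Fin n) ℝ) (hE : ∀ i j, |E i j| ≤ ε)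
    (i : Fin n) : ∑ j, |(pairMatrix n k ξ + E) i j| ≤ 10 / 9 := by
  have h1 : ∀ j, |(pairMatrix n k ξ + E) i j| ≤
      (if i = j then 1 else 0) + (if j ≠ i ∧ i.val / 2 = j.val / 2 then |ξ| else 0) + ε := by
    intro j
    rw [Matrix.add_apply]
    refine (abs_add_le _ _).trans (add_le_add ?_ (hE i j))
    simp only [pairMatrix, Matrix.of_apply]
    split_ifs <;> simp_all
  refine (Finset.sum_le_sum fun j _ => h1 j).trans ?_
  rw [Finset.sum_add_distrib, Finset.sum_add_distrib]
  have h2 : ∑ j : Fin n, (if j ≠ i ∧ i.val / 2 = j.val / 2 then |ξ| else 0) ≤ |ξ| := by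
    rw [← Finset.sum_filter, Finset.sum_const, nsmul_eq_mul]
    have : (Finset.univ.filter fun j : Fin n => j ≠ i ∧ i.val / 2 = j.val / 2).card ≤ 1 := by
      rw [Finset.card_le_one]
      intro a ha b hb
      simp only [Finset.mem_filter, Finset.mem_univ, true_and, ne_eq, Fin.ext_iff] at ha hb
      ext; omega
    have h3 : ((Finset.univ.filter fun j : Fin n => j ≠ i ∧ i.val / 2 = j.val / 2).card : ℝ) ≤ 1 := by
      exact_mod_cast this
    nlinarith [abs_nonneg ξ]
  have h3 : 1 / Q ≤ 1 / 10 := by gcongr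
  have h4 : 1 / Q ^ 2 ≤ 1 / 10 ^ 2 := by gcongr
  simp only [Finset.sum_ite_eq, Finset.mem_univ, if_true, Finset.sum_const, Finset.card_univ,
    Fintype.card_fin, nsmul_eq_mul]
  linarith

/-- Exponential moment bound. -/
lemma aux_main {Ω : Type*} [MeasurableSpace Ω] (μ : Measure Ω) [IsProbabilityMeasure μ] {n : ℕ}
    (Z : Fin n → Ω → ℝ) (C : Fin n → Fin n → ℝ) (hs : ∀ i j, C i j = C j i)
    (hr : ∀ i, ∑ j, |C i j| ≤ 10 / 9) (hZ : IsCenteredGaussianVector μ Z C)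
    (hm : ∀ i, AEMeasurable (Z i) μ)
    (p : Fin n → Prop) [DecidablePred p] :
    ∫⁻ ω, ENNReal.ofReal (Real.exp (3 / 10 * ∑ i, if p i then Z i ω ^ 2 else 0)) ∂μ ≤
      ENNReal.ofReal (Real.exp 1) ^ (Finset.univ.filter p).card := by
  set c : ℝ := √(3 / 5) with hc
  have hc2 : c ^ 2 = 3 / 5 := Real.sq_sqrt (by norm_num)
  set ν := gaussianReal 0 1 with hν
  set G := Measure.pi fun _ : Fin n => ν with hG
  -- linearization
  have h1 : ∀ z : Fin n → ℝ, ENNReal.ofReal (Real.exp (3 / 10 * ∑ i, if p i then z i ^ 2 else 0))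
      = ∫⁻ g, ENNReal.ofReal (Real.exp (∑ i, (if p i then c * g i else 0) * z i)) ∂G := by
    intro z
    have e1 : ∀ g : Fin n → ℝ,
        ENNReal.ofReal (Real.exp (∑ i, (if p i then c * g i else 0) * z i))
        = ∏ i, (fun x : ℝ => ENNReal.ofReal (Real.exp ((if p i then c * z i else 0) * x))) (g i) := by
      intro g
      rw [Real.exp_sum, ENNReal.ofReal_prod_of_nonneg (fun _ _ => (Real.exp_pos _).le)]
      refine Finset.prod_congr rfl fun i _ => ?_
      by_cases h : p i <;> simp [h]
      congr 2; ring
    simp_rw [e1]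
    rw [aux_pi_prod ν (fun i x => ENNReal.ofReal (Real.exp ((if p i then c * z i else 0) * x)))
      (fun i => by fun_prop)]
    rw [Finset.mul_sum, Real.exp_sum, ENNReal.ofReal_prod_of_nonneg (fun _ _ => (Real.exp_pos _).le)]
    refine Finset.prod_congr rfl fun i _ => ?_
    have e3 := aux_mgf (μ := ν) (X := fun x => (if p i then c * z i else 0) * x)
      (by rw [hν, gaussianReal_map_const_mul, mul_zero])
    rw [e3]
    by_cases h : p i
    · simp only [h, if_true]
      congr 2
      simp [mul_pow, hc2]
      ring
    · simp [h]
  simp_rw [fun ω => h1 (fun i => Z i ω)]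
  rw [lintegral_lintegral_swap]
  · have h2 : ∀ g : Fin n → ℝ,
        ∫⁻ ω, ENNReal.ofReal (Real.exp (∑ i, (if p i then c * g i else 0) * Z i ω)) ∂μ ≤
        ∏ i, (fun x : ℝ => if p i then ENNReal.ofReal (Real.exp (x ^ 2 / 3)) else 1) (g i) := by
      intro g
      rw [aux_mgf (hZ _)]
      have e2 : ∏ i, (fun x : ℝ => if p i then ENNReal.ofReal (Real.exp (x ^ 2 / 3)) else 1) (g i)
        = ENNReal.ofReal (Real.exp (∑ i, if p i then g i ^ 2 / 3 else 0)) := by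
        rw [Real.exp_sum, ENNReal.ofReal_prod_of_nonneg (fun _ _ => (Real.exp_pos _).le)]
        refine Finset.prod_congr rfl fun i _ => ?_
        by_cases h : p i <;> simp [h]
      rw [e2]
      apply ENNReal.ofReal_le_ofReal
      apply Real.exp_le_exp.2
      have h3 := aux_quad C hs _ hr (fun i => if p i then c * g i else 0)
      have h4 : ∑ i, (if p i then g i ^ 2 / 3 else 0) =
          (10 / 9 * ∑ i, (if p i then c * g i else 0) ^ 2) / 2 := by
        rw [Finset.mul_sum, Finset.sum_div]
        refine Finset.sum_congr rfl fun i _ => ?_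
        by_cases h : p i <;> simp [h, mul_pow, hc2]
        ring
      rw [h4, Real.coe_toNNReal']
      have h5 : 0 ≤ 10 / 9 * ∑ i, (if p i then c * g i else 0) ^ 2 := by positivity
      have := max_le h3 h5
      linarith
    refine (lintegral_mono h2).trans ?_
    rw [aux_pi_prod ν (fun i x => if p i then ENNReal.ofReal (Real.exp (x ^ 2 / 3)) else 1)
      (fun i => by by_cases h : p i <;> simp only [h, if_true, if_false] <;> fun_prop)]
    rw [← Finset.prod_const, Finset.prod_filter]
    refine Finset.prod_le_prod' fun i _ => ?_
    by_cases h : p i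
    · simp only [h, if_true]; exact aux_sq
    · simp [h]
  · refine ENNReal.measurable_ofReal.comp_aemeasurable (Real.measurable_exp.comp_aemeasurable ?_)
    refine Finset.aemeasurable_fun_sum _ fun i _ => AEMeasurable.mul ?_ ?_
    · by_cases h : p i <;> simp only [h, if_true, if_false] <;> fun_prop
    · exact (hm i).comp_fst

lemma aux_tail {Ω : Type*} [MeasurableSpace Ω] (μ : Measure Ω) [IsProbabilityMeasure μ] {n : ℕ}
    (Z : Fin n → Ω → ℝ) (C : Fin n → Fin n → ℝ) (hs : ∀ i j, C i j = C j i)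
    (hr : ∀ i, ∑ j, |C i j| ≤ 10 / 9) (hZ : IsCenteredGaussianVector μ Z C)
    (p : Fin n → Prop) [DecidablePred p] (m : ℕ) (hk : (Finset.univ.filter p).card ≤ 2 * m)
    (l : ℝ) :
    μ {ω | 10 * (m : ℝ) * l < ∑ i, if p i then Z i ω ^ 2 else 0} ≤
      ENNReal.ofReal (Real.exp (-3 * (m : ℝ) * l + 2 * m)) := by
  have hm : ∀ i, AEMeasurable (Z i) μ := by
    intro i
    have h := hZ (Pi.single i 1)
    have h2 : AEMeasurable (fun ω => ∑ j, (Pi.single i 1 : Fin n → ℝ) j * Z j ω) μ :=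
      aemeasurable_of_map_neZero (by rw [h]; infer_instance)
    simpa [Pi.single_apply] using h2
  have h := aux_main μ Z C hs hr hZ hm p
  have hmeas : AEMeasurable (fun ω => ENNReal.ofReal
      (Real.exp (3 / 10 * ∑ i, if p i then Z i ω ^ 2 else 0))) μ := by
    refine ENNReal.measurable_ofReal.comp_aemeasurable (Real.measurable_exp.comp_aemeasurable ?_)
    refine AEMeasurable.const_mul (Finset.aemeasurable_fun_sum _ fun i _ => ?_) _
    by_cases h : p i <;> simp only [h, if_true, if_false]
    · exact (hm i).pow_const 2
    · fun_prop
  have h2 := meas_ge_le_lintegral_div hmeas (ε := ENNReal.ofReal (Real.exp (3 * m * l)))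
    (by simp [Real.exp_pos]) ENNReal.ofReal_ne_top
  calc _ ≤ _ := measure_mono ?_
    _ ≤ _ := h2
    _ ≤ ENNReal.ofReal (Real.exp 1) ^ (2 * m) / ENNReal.ofReal (Real.exp (3 * m * l)) := by
      refine ENNReal.div_le_div_right (h.trans (pow_le_pow_right₀ ?_ hk)) _
      simp
    _ = _ := by
      rw [← ENNReal.ofReal_pow (Real.exp_pos _).le, ← ENNReal.ofReal_div_of_pos (Real.exp_pos _),
        ← Real.exp_nat_mul, ← Real.exp_sub]
      congr 2; push_cast; ring
  intro ω hω
  simp only [Set.mem_ofPred_eq] at hω ⊢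
  apply ENNReal.ofReal_le_ofReal
  apply Real.exp_le_exp.2
  linarith

theorem gaussian_vector_tails :
    ∃ K : ℝ, ∀ (n k : ℕ), 2 ≤ n → 1 ≤ k → 2 * k ≤ n →
      ∀ Q : ℝ, 10 ≤ Q → 3 ≤ (n : ℝ) * Q →
      ∀ ξ : ℝ, |ξ| ≤ 1 / Q →
      ∀ ε : ℝ, 0 ≤ ε → ε * n ≤ 1 / Q ^ 2 →
      ∀ E : Matrix (Fin n) (Fin n) ℝ, E.IsSymm → (∀ i j, |E i j| ≤ ε) →
      (pairMatrix n k ξ + E).PosSemidef →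
      ∀ (Ω : Type) (mΩ : MeasurableSpace Ω) (μ : Measure Ω), IsProbabilityMeasure μ →
      ∀ Z : Fin n → Ω → ℝ,
        IsCenteredGaussianVector μ Z (fun i j => (pairMatrix n k ξ + E) i j) →
        μ {ω | 10 * (n : ℝ) * Real.log ((n : ℝ) * Q) <
              ∑ i : Fin n, if 2 * k ≤ i.val then Z i ω ^ 2 else 0}
            ≤ ENNReal.ofReal
              (Real.exp (-3 * (n : ℝ) * Real.log ((n : ℝ) * Q) + K * n)) ∧
        μ {ω | 10 * (k : ℝ) * Real.log ((n : ℝ) * Q) <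
              ∑ i : Fin n, if i.val < 2 * k then Z i ω ^ 2 else 0}
            ≤ ENNReal.ofReal
              (Real.exp (-3 * (k : ℝ) * Real.log ((n : ℝ) * Q) + K * k)) := by
  refine ⟨2, ?_⟩
  intro n k hn hk hkn Q hQ _ ξ hξ ε hε hεn E hE hEε hpsd Ω mΩ μ hμ Z hZ
  have hs : ∀ i j, (pairMatrix n k ξ + E) i j = (pairMatrix n k ξ + E) j i := by
    intro i j
    simpa using hpsd.1.apply j i
  have hr := aux_row (k := k) hQ hξ hεn E hEε
  refine ⟨aux_tail μ Z _ hs hr hZ (fun i => 2 * k ≤ i.val) n ?_ _,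
    aux_tail μ Z _ hs hr hZ (fun i => i.val < 2 * k) k ?_ _⟩
  · refine (Finset.card_filter_le _ _).trans ?_
    simp; omega
  · have : (Finset.univ.filter fun i : Fin n => i.val < 2 * k).card ≤ (Finset.range (2 * k)).card :=
      Finset.card_le_card_of_injOn (fun i => i.val) (fun i hi => by simpa using hi)
        (fun a _ b _ hab => Fin.ext hab)
    simpa using this
end
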